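/- arXiv:1912.04215 — 2 statements merged into one kernel-verified Lean document; each statement's English description precedes it below -/
import Mathlib

section
/- There exists a constant C ∈ (0,∞) such that for all x ∈ ℝ, every n ∈ ℕ with δ = T/n ∈ (0,1), and all t ∈ [0,T], it holds that E[ ∫_0^t | σ(X^{(δ),x}_s)^2 − σ(X^{(δ),x}_{s̲})^2 | ds ] ≤ C(1 + x^2) · δ^{1/2}. -/
open MeasureTheory ProbabilityTheory

/-- Grid values of the Euler–Maruyama scheme with step size `δ` and initial value `x`. -/
noncomputable def emGrid {Ω : Type*} (μ σ ρ : ℝ → ℝ) (W N : ℝ → Ω → ℝ)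
    (δ : ℝ) (x : ℝ) : ℕ → Ω → ℝ
  | 0, _ => x
  | (j + 1), ω =>
      emGrid μ σ ρ W N δ x j ω
        + μ (emGrid μ σ ρ W N δ x j ω) * δ
        + σ (emGrid μ σ ρ W N δ x j ω) * (W (((j : ℝ) + 1) * δ) ω - W ((j : ℝ) * δ) ω)
        + ρ (emGrid μ σ ρ W N δ x j ω) * (N (((j : ℝ) + 1) * δ) ω - N ((j : ℝ) * δ) ω)

/-- The last grid point `t̲ = δ ⌊t/δ⌋` before time `t`. -/
noncomputable def lastGrid (δ t : ℝ) : ℝ := (⌊t / δ⌋.toNat : ℝ) * δ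

/-- The continuous-time Euler–Maruyama scheme
`X_t = X_t̲ + μ(X_t̲)(t - t̲) + σ(X_t̲)(W_t - W_t̲) + ρ(X_t̲)(N_t - N_t̲)`. -/
noncomputable def emProc {Ω : Type*} (μ σ ρ : ℝ → ℝ) (W N : ℝ → Ω → ℝ)
    (δ : ℝ) (x : ℝ) (t : ℝ) (ω : Ω) : ℝ :=
  emGrid μ σ ρ W N δ x (⌊t / δ⌋.toNat) ω
    + μ (emGrid μ σ ρ W N δ x (⌊t / δ⌋.toNat) ω) * (t - lastGrid δ t)
    + σ (emGrid μ σ ρ W N δ x (⌊t / δ⌋.toNat) ω) * (W t ω - W (lastGrid δ t) ω)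
    + ρ (emGrid μ σ ρ W N δ x (⌊t / δ⌋.toNat) ω) * (N t ω - N (lastGrid δ t) ω)


namespace EMAux


lemma poisson_moments (r : NNReal) :
    HasSum (fun n : ℕ => Real.exp (-r) * (r:ℝ) ^ n / (n.factorial : ℝ) * (n : ℝ)) r ∧
    HasSum (fun n : ℕ => Real.exp (-r) * (r:ℝ) ^ n / (n.factorial : ℝ) * (n : ℝ)^2) (r + r^2) := by
  have h0 := hasSum_one_poissonMeasure r
  have h1 : HasSum (fun n : ℕ => Real.exp (-r) * (r:ℝ) ^ n / (n.factorial : ℝ) * (n : ℝ)) r := by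
    rw [← hasSum_nat_add_iff' 1]
    have h := h0.mul_left (r:ℝ)
    simp only [Finset.sum_range_one, Nat.cast_zero, mul_zero, sub_zero]
    rw [mul_one] at h
    refine Eq.mpr (congrArg (fun f => HasSum f _) (funext fun n => ?_)) h
    rw [Nat.factorial_succ]; push_cast
    field_simp
    ring
  refine ⟨h1, ?_⟩
  rw [← hasSum_nat_add_iff' 1]
  have h := (h0.add h1).mul_left (r:ℝ)
  simp only [Finset.sum_range_one, Nat.cast_zero, mul_zero, sub_zero, ne_eq, OfNat.ofNat_ne_zero, not_false_eq_true, zero_pow]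
  have e : (r:ℝ) + (r:ℝ) ^ 2 = r * (1 + r) := by ring
  rw [e]
  refine Eq.mpr (congrArg (fun f => HasSum f _) (funext fun n => ?_)) h
  rw [Nat.factorial_succ]; push_cast
  field_simp
  ring

lemma poisson_rv {Ω : Type*} {m0 : MeasurableSpace Ω} (P : Measure Ω) (B : Ω → ℝ)
    (hB : Measurable B) (r : NNReal)
    (h : Measure.map B P = Measure.map (fun k : ℕ => (k : ℝ)) (poissonMeasure r)) :
    Integrable (fun ω => |B ω|) P ∧ ∫ ω, |B ω| ∂P = r ∧
    Integrable (fun ω => B ω ^ 2) P ∧ ∫ ω, B ω ^ 2 ∂P = r + r^2 := by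
  obtain ⟨h1, h2⟩ := poisson_moments r
  have hm : Measurable (fun k : ℕ => (k : ℝ)) := .of_discrete
  have i1 : Integrable (fun k : ℕ => |(k:ℝ)|) (poissonMeasure r) := by
    rw [integrable_poissonMeasure_iff]
    simpa using h1.summable
  have i2 : Integrable (fun k : ℕ => (k:ℝ)^2) (poissonMeasure r) := by
    rw [integrable_poissonMeasure_iff]
    simpa using h2.summable
  have c1 : AEStronglyMeasurable (fun x : ℝ => |x|) (Measure.map B P) := by fun_prop
  have c2 : AEStronglyMeasurable (fun x : ℝ => x^2) (Measure.map B P) := by fun_prop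
  have c1' := c1; have c2' := c2
  rw [h] at c1' c2'
  refine ⟨?_, ?_, ?_, ?_⟩
  · have := (integrable_map_measure c1 hB.aemeasurable).1 (by
      rw [h]; exact (integrable_map_measure c1' hm.aemeasurable).2 i1)
    exact this
  · rw [← integral_map hB.aemeasurable c1, h, integral_map hm.aemeasurable c1',
      integral_poissonMeasure]
    simpa using h1.tsum_eq
  · have := (integrable_map_measure c2 hB.aemeasurable).1 (by
      rw [h]; exact (integrable_map_measure c2' hm.aemeasurable).2 i2)
    exact this
  · rw [← integral_map hB.aemeasurable c2, h, integral_map hm.aemeasurable c2',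
      integral_poissonMeasure]
    simpa using h2.tsum_eq

lemma gauss_rv {Ω : Type*} {m0 : MeasurableSpace Ω} (P : Measure Ω) (A : Ω → ℝ)
    (hA : Measurable A) (v : NNReal)
    (h : Measure.map A P = gaussianReal 0 v) :
    Integrable A P ∧ ∫ ω, A ω ∂P = 0 ∧
    Integrable (fun ω => A ω ^ 2) P ∧ ∫ ω, A ω ^ 2 ∂P = v := by
  have m2 : MemLp id 2 (Measure.map A P) := by rw [h]; exact memLp_id_gaussianReal 2
  have m2' : MemLp A 2 P := by
    have := (memLp_map_measure_iff (by fun_prop) hA.aemeasurable).1 m2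
    exact this
  have : IsProbabilityMeasure P := by
    have : IsProbabilityMeasure (Measure.map A P) := by rw [h]; infer_instance
    exact (Measure.isProbabilityMeasure_map_iff hA.aemeasurable).1 this
  have e1 : ∫ ω, A ω ∂P = 0 := by
    have := integral_map (μ := P) hA.aemeasurable (f := fun x : ℝ => x) (by fun_prop)
    rw [← this, h, integral_id_gaussianReal]
  refine ⟨m2'.integrable (by norm_num), e1, m2'.integrable_sq, ?_⟩
  have v1 : Var[id; Measure.map A P] = v := by rw [h]; exact variance_id_gaussianReal
  rw [variance_map (by fun_prop) hA.aemeasurable] at v1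
  rw [← v1, variance_of_integral_eq_zero (by simpa using hA.aemeasurable) (by simpa using e1)]
  rfl

/-- Conditioning on an independent increment. -/
lemma cond_bound {Ω : Type*} (G : MeasurableSpace Ω) {m0 : MeasurableSpace Ω} (P : Measure Ω)
    [IsProbabilityMeasure P] (hG : G ≤ m0) (Y A B : Ω → ℝ) (hY : Measurable[G] Y)
    (hA : Measurable A) (hB : Measurable B)
    (hI : Indep (MeasurableSpace.comap (fun ω => (A ω, B ω)) inferInstance) G P)
    (φ : ℝ → ℝ → ℝ → ENNReal) (hφ : Measurable (fun p : ℝ × ℝ × ℝ => φ p.1 p.2.1 p.2.2))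
    (g : ℝ → ENNReal) (hg : Measurable g) (hb : ∀ y, ∫⁻ ω, φ y (A ω) (B ω) ∂P ≤ g y) :
    ∫⁻ ω, φ (Y ω) (A ω) (B ω) ∂P ≤ ∫⁻ ω, g (Y ω) ∂P := by
  have hY' : Measurable Y := hY.mono hG le_rfl
  have hAB : Measurable (fun ω => (A ω, B ω)) := hA.prodMk hB
  have hind : IndepFun Y (fun ω => (A ω, B ω)) P := by
    rw [IndepFun_iff_Indep]
    refine Indep.symm ?_
    exact indep_of_indep_of_le_right hI hY.comap_le
  have hmap := (indepFun_iff_map_prod_eq_prod_map_map hY'.aemeasurable hAB.aemeasurable).1 hind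
  calc ∫⁻ ω, φ (Y ω) (A ω) (B ω) ∂P
      = ∫⁻ p, φ p.1 p.2.1 p.2.2 ∂(Measure.map (fun ω => (Y ω, (A ω, B ω))) P) := by
        rw [lintegral_map hφ (hY'.prodMk hAB)]
    _ = ∫⁻ y, ∫⁻ z, φ y z.1 z.2 ∂(Measure.map (fun ω => (A ω, B ω)) P) ∂(Measure.map Y P) := by
        rw [hmap, lintegral_prod _ hφ.aemeasurable]
    _ ≤ ∫⁻ y, g y ∂(Measure.map Y P) := by
        refine lintegral_mono fun y => ?_
        have hφy : Measurable (fun z : ℝ × ℝ => φ y z.1 z.2) :=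
          hφ.comp (measurable_const.prodMk measurable_id)
        rw [lintegral_map hφy hAB]
        exact hb y
    _ = _ := lintegral_map hg hY'

lemma grid_approx (T : ℝ) (hT : 0 < T) : ∃ (a : ℕ → ℕ → ℝ) (q : ℕ → ℝ → ℕ),
    (∀ k i, a k i ∈ Set.Icc (0:ℝ) T) ∧ (∀ k, Measurable (q k)) ∧
    (∀ s ∈ Set.Ico (0:ℝ) T,
      Filter.Tendsto (fun k => a k (q k s)) Filter.atTop (nhdsWithin s (Set.Ioi s))) := by
  let a : ℕ → ℕ → ℝ := fun k i => min T (((i:ℝ) + 1) / ((k:ℝ) + 1))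
  let q : ℕ → ℝ → ℕ := fun k s => ⌊s * ((k:ℝ)+1)⌋.toNat
  have ha : ∀ k i, a k i ∈ Set.Icc (0:ℝ) T := fun k i =>
    ⟨le_min hT.le (by positivity), min_le_left _ _⟩
  have hq : ∀ k, Measurable (q k) := fun k =>
    (measurable_of_countable Int.toNat).comp
      (Int.measurable_floor.comp (measurable_id.mul_const _))
  have hlim : ∀ s ∈ Set.Ico (0:ℝ) T,
      Filter.Tendsto (fun k => a k (q k s)) Filter.atTop (nhdsWithin s (Set.Ioi s)) := by
    intro s hs
    have hqs : ∀ k, (q k s : ℝ) ≤ s * ((k:ℝ)+1) ∧ s * ((k:ℝ)+1) < q k s + 1 := by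
      intro k
      have hnn : 0 ≤ ⌊s * ((k:ℝ)+1)⌋ := Int.floor_nonneg.2 (mul_nonneg hs.1 (by positivity))
      have he : ((q k s : ℕ) : ℝ) = (⌊s * ((k:ℝ)+1)⌋ : ℝ) := by
        have := Int.toNat_of_nonneg hnn
        rw [← Int.cast_natCast]; exact congrArg _ this
      rw [he]
      exact ⟨Int.floor_le _, Int.lt_floor_add_one _⟩
    have hgt : ∀ k, s < a k (q k s) := by
      intro k
      refine lt_min hs.2 ?_
      rw [lt_div_iff₀ (by positivity)]
      exact (hqs k).2
    rw [tendsto_nhdsWithin_iff]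
    refine ⟨?_, Filter.Eventually.of_forall hgt⟩
    have hup : Filter.Tendsto (fun k : ℕ => s + 1 / ((k:ℝ)+1)) Filter.atTop (nhds s) := by
      simpa using (tendsto_one_div_add_atTop_nhds_zero_nat (𝕜 := ℝ)).const_add s
    refine tendsto_of_tendsto_of_tendsto_of_le_of_le tendsto_const_nhds hup
      (fun k => (hgt k).le) (fun k => ?_)
    refine (min_le_right _ _).trans ?_
    rw [add_div]
    gcongr
    rw [div_le_iff₀ (by positivity)]
    exact (hqs k).1
  exact ⟨a, q, ha, hq, hlim⟩

/-- Fatou argument replacing Tonelli. -/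
lemma fatou_swap {Ω : Type*} {m0 : MeasurableSpace Ω} (P : Measure Ω) [IsProbabilityMeasure P]
    (T : ℝ) (hT : 0 < T) (f : ℝ → Ω → ENNReal)
    (hf : ∀ s ∈ Set.Icc (0:ℝ) T, Measurable (f s))
    (hrc : ∀ᵐ ω ∂P, ∀ s ∈ Set.Ico (0:ℝ) T,
      Filter.Tendsto (fun u => f u ω) (nhdsWithin s (Set.Ioi s)) (nhds (f s ω)))
    (M : ENNReal) (hM : ∀ s ∈ Set.Icc (0:ℝ) T, ∫⁻ ω, f s ω ∂P ≤ M)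
    (t : ℝ) (ht : t ∈ Set.Icc (0:ℝ) T) :
    ∫⁻ ω, (∫⁻ s in Set.Icc (0:ℝ) t, f s ω) ∂P ≤ M * ENNReal.ofReal t := by
  obtain ⟨a, q, ha, hq, hlim⟩ := grid_approx T hT
  have hJ : ∀ k, Measurable (fun p : Ω × ℝ => f (a k (q k p.2)) p.1) := by
    intro k
    have h1 : Measurable (fun p : Ω × ℕ => f (a k p.2) p.1) :=
      measurable_from_prod_countable_left fun i => hf _ (ha k i)
    exact h1.comp (measurable_fst.prodMk ((hq k).comp measurable_snd))
  have hae : ∀ᵐ s ∂(volume.restrict (Set.Icc (0:ℝ) t)), s ∈ Set.Ico (0:ℝ) T := by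
    have h1 : ∀ᵐ s ∂(volume.restrict (Set.Icc (0:ℝ) t)), s ≠ T :=
      ae_restrict_of_ae (by simp [ae_iff])
    filter_upwards [h1, ae_restrict_mem measurableSet_Icc] with s h1 h2
    exact ⟨h2.1, lt_of_le_of_ne (h2.2.trans ht.2) h1⟩
  calc ∫⁻ ω, (∫⁻ s in Set.Icc (0:ℝ) t, f s ω) ∂P
      ≤ ∫⁻ ω, Filter.liminf (fun k => ∫⁻ s in Set.Icc (0:ℝ) t, f (a k (q k s)) ω)
          Filter.atTop ∂P := by
        refine lintegral_mono_ae ?_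
        filter_upwards [hrc] with ω hω
        refine le_trans ?_ (lintegral_liminf_le
          (fun k => (hJ k).comp (measurable_const.prodMk measurable_id)))
        refine lintegral_mono_ae ?_
        filter_upwards [hae] with s hs
        exact (((hω s hs).comp (hlim s hs)).liminf_eq).ge
    _ ≤ Filter.liminf (fun k => ∫⁻ ω, (∫⁻ s in Set.Icc (0:ℝ) t, f (a k (q k s)) ω) ∂P)
          Filter.atTop := lintegral_liminf_le (fun k => (hJ k).lintegral_prod_right')
    _ ≤ Filter.liminf (fun _ : ℕ => M * ENNReal.ofReal t) Filter.atTop := by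
        refine Filter.liminf_le_liminf (Filter.Eventually.of_forall fun k => ?_)
        rw [lintegral_lintegral_swap (hJ k).aemeasurable]
        calc _ ≤ ∫⁻ s in Set.Icc (0:ℝ) t, M := lintegral_mono fun s => hM _ (ha _ _)
          _ = _ := by simp
    _ = _ := by simp

end EMAux

namespace EMAux

lemma lip_growth (μ : ℝ → ℝ) (s : Set ℝ) (h : ∃ K : NNReal, LipschitzOnWith K μ s) :
    ∃ K : ℝ, ∀ y ∈ s, |μ y| ≤ K * (1 + |y|) := by
  obtain ⟨L, hL⟩ := h
  rcases s.eq_empty_or_nonempty with rfl | ⟨b, hb⟩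
  · exact ⟨0, by simp⟩
  refine ⟨|μ b| + L * (1 + |b|), fun y hy => ?_⟩
  have h1 := hL.dist_le_mul y hy b hb
  rw [Real.dist_eq, Real.dist_eq] at h1
  have h2 : |μ y| ≤ |μ y - μ b| + |μ b| := by
    have := abs_add_le (μ y - μ b) (μ b); simpa using this
  have h3 : |y - b| ≤ |y| + |b| := abs_sub y b
  have h4 : (L:ℝ) * |y - b| ≤ L * (|y| + |b|) := by gcongr
  have : 0 ≤ |μ b| * |y| := by positivity
  have : 0 ≤ (L:ℝ) * |b| * |y| := by positivity
  have : (0:ℝ) ≤ L := L.2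
  nlinarith

lemma pw_growth (μ : ℝ → ℝ) (m : ℕ) (hm : 0 < m) (ζ : Fin m → ℝ)
    (hμ_low : ∃ K : NNReal, LipschitzOnWith K μ (Set.Iio (ζ ⟨0, hm⟩)))
    (hμ_high : ∃ K : NNReal, LipschitzOnWith K μ (Set.Ioi (ζ ⟨m - 1, Nat.sub_lt hm one_pos⟩)))
    (hμ_mid : ∀ (k : Fin m) (h : (k : ℕ) + 1 < m),
      ∃ K : NNReal, LipschitzOnWith K μ (Set.Ioo (ζ k) (ζ ⟨(k : ℕ) + 1, h⟩))) :
    ∃ K : ℝ, ∀ y, |μ y| ≤ K * (1 + |y|) := by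
  -- growth on the region up to and including the k-th point
  have key : ∀ k (hk : k < m), ∃ K : ℝ, ∀ y ≤ ζ ⟨k, hk⟩, |μ y| ≤ K * (1 + |y|) := by
    intro k
    induction k with
    | zero =>
      intro hk
      obtain ⟨K, hK⟩ := lip_growth μ _ hμ_low
      refine ⟨max K |μ (ζ ⟨0, hk⟩)|, fun y hy => ?_⟩
      have hp : 0 ≤ 1 + |y| := by positivity
      rcases hy.lt_or_eq with h | h
      · exact (hK y h).trans (mul_le_mul_of_nonneg_right (le_max_left _ _) hp)
      · rw [← h]
        refine le_trans ?_ (mul_le_mul_of_nonneg_right (le_max_right _ _) hp)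
        nlinarith [abs_nonneg y, abs_nonneg (μ y), mul_nonneg (abs_nonneg (μ y)) (abs_nonneg y)]
    | succ k ih =>
      intro hk
      obtain ⟨K, hK⟩ := ih (by omega)
      obtain ⟨K', hK'⟩ := lip_growth μ _ (hμ_mid ⟨k, by omega⟩ hk)
      refine ⟨max (max K K') |μ (ζ ⟨k + 1, hk⟩)|, fun y hy => ?_⟩
      have hp : 0 ≤ 1 + |y| := by positivity
      rcases hy.lt_or_eq with h | h
      · refine le_trans ?_ (mul_le_mul_of_nonneg_right (le_max_left _ _) hp)
        rcases le_or_gt y (ζ ⟨k, by omega⟩) with h' | h'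
        · exact (hK y h').trans (mul_le_mul_of_nonneg_right (le_max_left _ _) hp)
        · exact (hK' y ⟨h', h⟩).trans (mul_le_mul_of_nonneg_right (le_max_right _ _) hp)
      · rw [← h]
        refine le_trans ?_ (mul_le_mul_of_nonneg_right (le_max_right _ _) hp)
        nlinarith [abs_nonneg y, abs_nonneg (μ y), mul_nonneg (abs_nonneg (μ y)) (abs_nonneg y)]
  obtain ⟨K, hK⟩ := key (m - 1) (Nat.sub_lt hm one_pos)
  obtain ⟨K', hK'⟩ := lip_growth μ _ hμ_high
  refine ⟨max K K', fun y => ?_⟩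
  have hp : 0 ≤ 1 + |y| := by positivity
  rcases le_or_gt y (ζ ⟨m - 1, Nat.sub_lt hm one_pos⟩) with h' | h'
  · exact (hK y h').trans (mul_le_mul_of_nonneg_right (le_max_left _ _) hp)
  · exact (hK' y h').trans (mul_le_mul_of_nonneg_right (le_max_right _ _) hp)

/-- Moment properties of the driving increments over a step of length `h`. -/
structure Inc {Ω : Type*} {m0 : MeasurableSpace Ω} (P : Measure Ω) (A B : Ω → ℝ) (h Λ : ℝ) :
    Prop where
  iA : Integrable A P
  eA : ∫ ω, A ω ∂P = 0
  iA2 : Integrable (fun ω => A ω ^ 2) P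
  eA2 : ∫ ω, A ω ^ 2 ∂P ≤ h
  iB : Integrable (fun ω => |B ω|) P
  eB : ∫ ω, |B ω| ∂P ≤ Λ * h
  iB2 : Integrable (fun ω => B ω ^ 2) P
  eB2 : ∫ ω, B ω ^ 2 ∂P ≤ Λ * h

lemma sq_one_add_abs (y : ℝ) : (1 + |y|) ^ 2 ≤ 2 * (1 + y ^ 2) := by
  nlinarith [sq_abs y, sq_nonneg (1 - |y|)]

lemma onestep_growth {Ω : Type*} {m0 : MeasurableSpace Ω} (P : Measure Ω) [IsProbabilityMeasure P]
    (A B : Ω → ℝ) (h Λ : ℝ) (hh0 : 0 ≤ h) (hh1 : h ≤ 1) (hΛ : 0 ≤ Λ) (hI : Inc P A B h Λ)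
    (K : ℝ) (hK : 0 ≤ K) (y b s r : ℝ) (hb : |b| ≤ K * (1 + |y|)) (hs : |s| ≤ K * (1 + |y|))
    (hr : |r| ≤ K * (1 + |y|)) :
    ∫⁻ ω, ENNReal.ofReal (1 + (y + b * h + s * A ω + r * B ω) ^ 2) ∂P ≤
      ENNReal.ofReal ((1 + 2 * (2 * K + K^2 + 2 * (1 + K) * K * Λ + 2 * K^2 * (1 + Λ)) * h)
        * (1 + y ^ 2)) := by
  set a := y + b * h with ha
  have hint : Integrable (fun ω => (1 + a ^ 2) + 2 * a * s * A ω + 2 * |a| * |r| * |B ω|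
      + 2 * s ^ 2 * A ω ^ 2 + 2 * r ^ 2 * B ω ^ 2) P :=
    ((((integrable_const _).add (hI.iA.const_mul _)).add (hI.iB.const_mul _)).add
      (hI.iA2.const_mul _)).add (hI.iB2.const_mul _)
  have hval : ∫ ω, ((1 + a ^ 2) + 2 * a * s * A ω + 2 * |a| * |r| * |B ω|
      + 2 * s ^ 2 * A ω ^ 2 + 2 * r ^ 2 * B ω ^ 2) ∂P =
      (1 + a ^ 2) + 2 * |a| * |r| * ∫ ω, |B ω| ∂P + 2 * s ^ 2 * ∫ ω, A ω ^ 2 ∂P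
        + 2 * r ^ 2 * ∫ ω, B ω ^ 2 ∂P := by
    have i1 : Integrable (fun _ : Ω => 1 + a ^ 2) P := integrable_const _
    have i2 : Integrable (fun ω => (1 + a ^ 2) + 2 * a * s * A ω) P :=
      i1.add (hI.iA.const_mul (2 * a * s))
    have i3 : Integrable (fun ω => (1 + a ^ 2) + 2 * a * s * A ω + 2 * |a| * |r| * |B ω|) P :=
      i2.add (hI.iB.const_mul (2 * |a| * |r|))
    have i4 : Integrable (fun ω => (1 + a ^ 2) + 2 * a * s * A ω + 2 * |a| * |r| * |B ω|
        + 2 * s ^ 2 * A ω ^ 2) P := i3.add (hI.iA2.const_mul (2 * s ^ 2))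
    rw [integral_add i4 (hI.iB2.const_mul (2 * r ^ 2)),
      integral_add i3 (hI.iA2.const_mul (2 * s ^ 2)),
      integral_add i2 (hI.iB.const_mul (2 * |a| * |r|)),
      integral_add i1 (hI.iA.const_mul (2 * a * s))]
    simp only [integral_const_mul, hI.eA]
    simp
  have hpt : ∀ ω, 1 + (a + s * A ω + r * B ω) ^ 2 ≤ (1 + a ^ 2) + 2 * a * s * A ω
      + 2 * |a| * |r| * |B ω| + 2 * s ^ 2 * A ω ^ 2 + 2 * r ^ 2 * B ω ^ 2 := by
    intro ω
    have h1 : a * r * B ω ≤ |a| * |r| * |B ω| := by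
      rw [← abs_mul, ← abs_mul]; exact le_abs_self _
    nlinarith [sq_nonneg (s * A ω - r * B ω)]
  calc ∫⁻ ω, ENNReal.ofReal (1 + (a + s * A ω + r * B ω) ^ 2) ∂P
      ≤ ∫⁻ ω, ENNReal.ofReal ((1 + a ^ 2) + 2 * a * s * A ω
      + 2 * |a| * |r| * |B ω| + 2 * s ^ 2 * A ω ^ 2 + 2 * r ^ 2 * B ω ^ 2) ∂P :=
        lintegral_mono fun ω => ENNReal.ofReal_le_ofReal (hpt ω)
    _ = ENNReal.ofReal (∫ ω, ((1 + a ^ 2) + 2 * a * s * A ω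
      + 2 * |a| * |r| * |B ω| + 2 * s ^ 2 * A ω ^ 2 + 2 * r ^ 2 * B ω ^ 2) ∂P) := by
        rw [ofReal_integral_eq_lintegral_ofReal hint]
        exact Filter.Eventually.of_forall fun ω => le_trans (by positivity) (hpt ω)
    _ ≤ _ := by
        refine ENNReal.ofReal_le_ofReal ?_
        rw [hval]
        set u := 1 + |y| with hu
        have hu0 : 0 ≤ u := by positivity
        have hu2 : u ^ 2 ≤ 2 * (1 + y ^ 2) := sq_one_add_abs y
        have hyu : |y| ≤ u := by rw [hu]; linarith
        have hau : |a| ≤ (1 + K) * u := by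
          calc |a| ≤ |y| + |b * h| := abs_add_le _ _
            _ = |y| + |b| * h := by rw [abs_mul, abs_of_nonneg hh0]
            _ ≤ u + K * u * 1 := by gcongr
            _ = _ := by ring
        have e1 : a ^ 2 ≤ y ^ 2 + (2 * K + K ^ 2) * u ^ 2 * h := by
          have p1 : y * b ≤ u * (K * u) := by
            calc y * b ≤ |y * b| := le_abs_self _
              _ = |y| * |b| := abs_mul _ _
              _ ≤ _ := by gcongr
          have p2 : b ^ 2 ≤ (K * u) ^ 2 := by rw [← sq_abs b]; gcongr
          have p3 : b ^ 2 * h ^ 2 ≤ (K * u) ^ 2 * h := by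
            have : h ^ 2 ≤ h := by nlinarith
            gcongr
          have p4 : y * b * h ≤ u * (K * u) * h := by gcongr
          calc a ^ 2 = y ^ 2 + 2 * (y * b * h) + b ^ 2 * h ^ 2 := by rw [ha]; ring
            _ ≤ y ^ 2 + 2 * (u * (K * u) * h) + (K * u) ^ 2 * h := by linarith
            _ = _ := by ring
        have e2 : 2 * |a| * |r| * ∫ ω, |B ω| ∂P ≤ 2 * ((1 + K) * u) * (K * u) * (Λ * h) := by
          have h0 := hI.eB
          have : 0 ≤ ∫ ω, |B ω| ∂P := integral_nonneg fun ω => abs_nonneg _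
          gcongr
        have e3 : 2 * s ^ 2 * ∫ ω, A ω ^ 2 ∂P ≤ 2 * (K * u) ^ 2 * h := by
          have : 0 ≤ ∫ ω, A ω ^ 2 ∂P := integral_nonneg fun ω => sq_nonneg _
          rw [← sq_abs s]
          gcongr
          exact hI.eA2
        have e4 : 2 * r ^ 2 * ∫ ω, B ω ^ 2 ∂P ≤ 2 * (K * u) ^ 2 * (Λ * h) := by
          have : 0 ≤ ∫ ω, B ω ^ 2 ∂P := integral_nonneg fun ω => sq_nonneg _
          rw [← sq_abs r]
          gcongr
          exact hI.eB2
        have e5 : (2 * K + K^2 + 2 * (1 + K) * K * Λ + 2 * K^2 * (1 + Λ)) * h * u ^ 2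
          ≤ (2 * K + K^2 + 2 * (1 + K) * K * Λ + 2 * K^2 * (1 + Λ)) * h * (2 * (1 + y ^ 2)) := by
          gcongr
        linarith

lemma three_sq (p q r : ℝ) : (p + q + r) ^ 2 ≤ 3 * (p ^ 2 + q ^ 2 + r ^ 2) := by
  nlinarith [sq_nonneg (p - q), sq_nonneg (p - r), sq_nonneg (q - r)]

lemma sq_le_aux (h δ : ℝ) (h0 : 0 ≤ h) (h1 : h ≤ δ) (h2 : δ ≤ 1) : h ^ 2 ≤ δ := by
  nlinarith

set_option maxHeartbeats 1000000 in
lemma onestep_diff {Ω : Type*} {m0 : MeasurableSpace Ω} (P : Measure Ω) [IsProbabilityMeasure P]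
    (A B : Ω → ℝ) (h δ Λ : ℝ) (hh0 : 0 ≤ h) (hhδ : h ≤ δ) (hδ0 : 0 < δ) (hδ1 : δ ≤ 1)
    (hΛ : 0 ≤ Λ) (hI : Inc P A B h Λ)
    (K : ℝ) (hK : 0 ≤ K) (σ : ℝ → ℝ) (hσ : ∀ x y, |σ x - σ y| ≤ K * |x - y|)
    (y b r : ℝ) (hb : |b| ≤ K * (1 + |y|)) (hs : |σ y| ≤ K * (1 + |y|))
    (hr : |r| ≤ K * (1 + |y|)) :
    ∫⁻ ω, ENNReal.ofReal |σ (y + b * h + σ y * A ω + r * B ω) ^ 2 - σ y ^ 2| ∂P ≤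
      ENNReal.ofReal ((2 * (2 * K^3 * (2 + Λ) + 3 * K^4 * (2 + Λ))) * Real.sqrt δ
        * (1 + y ^ 2)) := by
  set u := 1 + |y| with hu
  have hu0 : 0 ≤ u := by positivity
  have hu2 : u ^ 2 ≤ 2 * (1 + y ^ 2) := sq_one_add_abs y
  set q := Real.sqrt δ with hq
  have hq0 : 0 < q := Real.sqrt_pos.2 hδ0
  have hqq : q * q = δ := Real.mul_self_sqrt hδ0.le
  have hδq : δ ≤ q := by nlinarith
  set c1 := u ^ 2 * (2 * K ^ 3) with hc1
  set c2 := u ^ 2 * (3 * K ^ 4) with hc2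
  have hc10 : 0 ≤ c1 := by positivity
  have hc20 : 0 ≤ c2 := by positivity
  have hpt : ∀ ω, |σ (y + b * h + σ y * A ω + r * B ω) ^ 2 - σ y ^ 2| ≤
      (c1 * (δ + q / 2) + c2 * δ) + (c1 * (1 / (2 * q)) + c2) * A ω ^ 2 + c1 * |B ω|
        + c2 * B ω ^ 2 := by
    intro ω
    set D := b * h + σ y * A ω + r * B ω with hD
    set Z := h + |A ω| + |B ω| with hZ
    have hZ0 : 0 ≤ Z := by positivity
    have hDZ : |D| ≤ K * u * Z := by
      calc |D| ≤ |b * h| + |σ y * A ω| + |r * B ω| := abs_add_three _ _ _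
        _ = |b| * h + |σ y| * |A ω| + |r| * |B ω| := by
            rw [abs_mul, abs_mul, abs_mul, abs_of_nonneg hh0]
        _ ≤ (K * u) * h + (K * u) * |A ω| + (K * u) * |B ω| := by gcongr
        _ = _ := by ring
    have hx : y + b * h + σ y * A ω + r * B ω = y + D := by rw [hD]; ring
    rw [hx]
    have h1 : |σ (y + D) - σ y| ≤ K * |D| := by simpa using hσ (y + D) y
    have h2 : |σ (y + D) + σ y| ≤ K * |D| + 2 * (K * u) := by
      have : σ (y + D) + σ y = (σ (y + D) - σ y) + 2 * σ y := by ring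
      rw [this]
      refine (abs_add_le _ _).trans ?_
      rw [abs_mul, abs_two]
      linarith
    have h3 : |σ (y + D) ^ 2 - σ y ^ 2| ≤ (K * (K * u * Z)) * (K * (K * u * Z) + 2 * (K * u)) := by
      have : σ (y + D) ^ 2 - σ y ^ 2 = (σ (y + D) - σ y) * (σ (y + D) + σ y) := by ring
      rw [this, abs_mul]
      have h1' : |σ (y + D) - σ y| ≤ K * (K * u * Z) := h1.trans (by gcongr)
      have h2' : |σ (y + D) + σ y| ≤ K * (K * u * Z) + 2 * (K * u) := h2.trans (by gcongr)
      gcongr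
    have hA1 : |A ω| ≤ q / 2 + 1 / (2 * q) * A ω ^ 2 := by
      have : q / 2 + 1 / (2 * q) * A ω ^ 2 - |A ω| = (q - |A ω|) ^ 2 / (2 * q) := by
        rw [sub_sq, sq_abs]; field_simp; ring
      have h0 : 0 ≤ (q - |A ω|) ^ 2 / (2 * q) := by positivity
      linarith
    have hZ1 : Z ≤ δ + q / 2 + 1 / (2 * q) * A ω ^ 2 + |B ω| := by rw [hZ]; linarith
    have hZ2 : Z ^ 2 ≤ 3 * (δ + A ω ^ 2 + B ω ^ 2) := by
      have hh : h ^ 2 ≤ δ := sq_le_aux h δ hh0 hhδ hδ1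
      have h4 := three_sq h |A ω| |B ω|
      rw [sq_abs, sq_abs, ← hZ] at h4
      linarith
    calc _ ≤ _ := h3
      _ = c1 * Z + u ^ 2 * K ^ 4 * Z ^ 2 := by rw [hc1]; ring
      _ ≤ c1 * (δ + q / 2 + 1 / (2 * q) * A ω ^ 2 + |B ω|)
          + u ^ 2 * K ^ 4 * (3 * (δ + A ω ^ 2 + B ω ^ 2)) := by gcongr
      _ = _ := by rw [hc2]; ring
  have i1 : Integrable (fun _ : Ω => c1 * (δ + q / 2) + c2 * δ) P := integrable_const _
  have i2 : Integrable (fun ω => (c1 * (δ + q / 2) + c2 * δ)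
      + (c1 * (1 / (2 * q)) + c2) * A ω ^ 2) P :=
    i1.add (hI.iA2.const_mul (c1 * (1 / (2 * q)) + c2))
  have i3 : Integrable (fun ω => (c1 * (δ + q / 2) + c2 * δ)
      + (c1 * (1 / (2 * q)) + c2) * A ω ^ 2 + c1 * |B ω|) P := i2.add (hI.iB.const_mul c1)
  have i4 : Integrable (fun ω => (c1 * (δ + q / 2) + c2 * δ)
      + (c1 * (1 / (2 * q)) + c2) * A ω ^ 2 + c1 * |B ω| + c2 * B ω ^ 2) P :=
    i3.add (hI.iB2.const_mul c2)
  have hval : ∫ ω, ((c1 * (δ + q / 2) + c2 * δ) + (c1 * (1 / (2 * q)) + c2) * A ω ^ 2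
      + c1 * |B ω| + c2 * B ω ^ 2) ∂P = (c1 * (δ + q / 2) + c2 * δ)
      + (c1 * (1 / (2 * q)) + c2) * ∫ ω, A ω ^ 2 ∂P + c1 * ∫ ω, |B ω| ∂P
        + c2 * ∫ ω, B ω ^ 2 ∂P := by
    rw [integral_add i3 (hI.iB2.const_mul c2),
      integral_add i2 (hI.iB.const_mul c1),
      integral_add i1 (hI.iA2.const_mul (c1 * (1 / (2 * q)) + c2))]
    simp only [integral_const_mul]
    simp
  calc _ ≤ ∫⁻ ω, ENNReal.ofReal ((c1 * (δ + q / 2) + c2 * δ)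
      + (c1 * (1 / (2 * q)) + c2) * A ω ^ 2 + c1 * |B ω| + c2 * B ω ^ 2) ∂P :=
        lintegral_mono fun ω => ENNReal.ofReal_le_ofReal (hpt ω)
    _ = ENNReal.ofReal (∫ ω, ((c1 * (δ + q / 2) + c2 * δ)
      + (c1 * (1 / (2 * q)) + c2) * A ω ^ 2 + c1 * |B ω| + c2 * B ω ^ 2) ∂P) := by
        refine (ofReal_integral_eq_lintegral_ofReal i4 ?_).symm
        exact Filter.Eventually.of_forall fun ω => le_trans (abs_nonneg _) (hpt ω)
    _ ≤ _ := by
        refine ENNReal.ofReal_le_ofReal ?_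
        rw [hval]
        have e1 : (c1 * (1 / (2 * q)) + c2) * ∫ ω, A ω ^ 2 ∂P ≤
            (c1 * (1 / (2 * q)) + c2) * δ := by
          gcongr
          exact hI.eA2.trans hhδ
        have e1' : (1 / (2 * q)) * δ = q / 2 := by
          rw [← hqq]; field_simp
        have hΛδ : Λ * h ≤ Λ * q := by
          gcongr; linarith
        have e2 : c1 * ∫ ω, |B ω| ∂P ≤ c1 * (Λ * q) := by
          gcongr
          exact hI.eB.trans hΛδ
        have e3 : c2 * ∫ ω, B ω ^ 2 ∂P ≤ c2 * (Λ * q) := by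
          gcongr
          exact hI.eB2.trans hΛδ
        calc _ ≤ (c1 * (δ + q / 2) + c2 * δ) + (c1 * (1 / (2 * q)) + c2) * δ
              + c1 * (Λ * q) + c2 * (Λ * q) := by linarith
          _ = c1 * (δ + q) + c2 * (2 * δ) + (c1 + c2) * (Λ * q) := by
              rw [add_mul (c1 * (1 / (2 * q))), mul_assoc c1 (1 / (2 * q)), e1']; ring
          _ ≤ c1 * (q + q) + c2 * (2 * q) + (c1 + c2) * (Λ * q) := by gcongr
          _ = ((2 * K^3 * (2 + Λ) + 3 * K^4 * (2 + Λ)) * q) * u ^ 2 := by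
              rw [hc1, hc2]; ring
          _ ≤ ((2 * K^3 * (2 + Λ) + 3 * K^4 * (2 + Λ)) * q) * (2 * (1 + y ^ 2)) := by
              gcongr
          _ = _ := by ring

end EMAux

namespace EMAux

lemma inc_of_laws {Ω : Type*} {m0 : MeasurableSpace Ω} (P : Measure Ω)
    (A B : Ω → ℝ) (hA : Measurable A) (hB : Measurable B) (lam : ℝ → ℝ) (L s t : ℝ)
    (hst : s ≤ t) (h1 : t - s ≤ 1)
    (hlam : ∀ u ∈ Set.Icc s t, |lam u| ≤ L)
    (gA : Measure.map A P = gaussianReal 0 (Real.toNNReal (t - s)))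
    (gB : Measure.map B P = Measure.map (fun k : ℕ => (k : ℝ))
            (poissonMeasure (Real.toNNReal (∫ u in s..t, lam u)))) :
    Inc P A B (t - s) (L + L ^ 2) := by
  obtain ⟨a1, a2, a3, a4⟩ := gauss_rv P A hA _ gA
  obtain ⟨b1, b2, b3, b4⟩ := poisson_rv P B hB _ gB
  have hL : 0 ≤ L := (abs_nonneg _).trans (hlam s ⟨le_rfl, hst⟩)
  have hts : 0 ≤ t - s := sub_nonneg.2 hst
  set κ := (Real.toNNReal (∫ u in s..t, lam u) : ℝ) with hκ
  have hκ0 : 0 ≤ κ := NNReal.coe_nonneg _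
  have hκ1 : κ ≤ L * (t - s) := by
    rw [hκ, Real.coe_toNNReal', max_le_iff]
    refine ⟨?_, by positivity⟩
    have := intervalIntegral.norm_integral_le_of_norm_le_const (a := s) (b := t) (f := lam)
      (C := L) (fun u hu => by
        rw [Set.uIoc_of_le hst] at hu
        exact hlam u ⟨hu.1.le, hu.2⟩)
    rw [abs_of_nonneg hts] at this
    exact (le_abs_self _).trans this
  have hκ2 : κ ^ 2 ≤ L ^ 2 * (t - s) := by
    calc κ ^ 2 ≤ (L * (t - s)) ^ 2 := by gcongr
      _ = L ^ 2 * ((t - s) * (t - s)) := by ring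
      _ ≤ L ^ 2 * ((t - s) * 1) := by gcongr
      _ = _ := by ring
  refine ⟨a1, a2, a3, ?_, b1, ?_, b3, ?_⟩
  · rw [a4, Real.coe_toNNReal _ hts]
  · rw [b2]
    have : 0 ≤ L ^ 2 * (t - s) := by positivity
    rw [add_mul]; linarith
  · rw [b4, add_mul]; linarith

section Scheme

variable {Ω : Type*} {m0 : MeasurableSpace Ω}

lemma grid_meas (F : Filtration ℝ m0) (T : ℝ) (W N : ℝ → Ω → ℝ)
    (hW : ∀ t ∈ Set.Icc (0:ℝ) T, Measurable[F t] (W t))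
    (hN : ∀ t ∈ Set.Icc (0:ℝ) T, Measurable[F t] (N t))
    (μ σ ρ : ℝ → ℝ) (hμ : Measurable μ) (hσ : Measurable σ) (hρ : Measurable ρ)
    (δ : ℝ) (hδ : 0 < δ) (x : ℝ) (j : ℕ) (hj : (j:ℝ) * δ ≤ T) :
    Measurable[F (j * δ)] (emGrid μ σ ρ W N δ x j) := by
  induction j with
  | zero => exact @measurable_const _ _ _ (F _) _
  | succ j ih =>
    push_cast at hj
    have hle : (j:ℝ) * δ ≤ ((j:ℝ) + 1) * δ := by gcongr; linarith
    have h0 : 0 ≤ (j:ℝ) * δ := by positivity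
    have ih' := (ih (hle.trans hj)).mono (F.mono hle) le_rfl
    have w1 := hW _ ⟨h0.trans hle, hj⟩
    have w0 := (hW _ ⟨h0, hle.trans hj⟩).mono (F.mono hle) le_rfl
    have n1 := hN _ ⟨h0.trans hle, hj⟩
    have n0 := (hN _ ⟨h0, hle.trans hj⟩).mono (F.mono hle) le_rfl
    have e : emGrid μ σ ρ W N δ x (j+1) = fun ω => emGrid μ σ ρ W N δ x j ω
        + μ (emGrid μ σ ρ W N δ x j ω) * δ
        + σ (emGrid μ σ ρ W N δ x j ω) * (W (((j : ℝ) + 1) * δ) ω - W ((j : ℝ) * δ) ω)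
        + ρ (emGrid μ σ ρ W N δ x j ω) * (N (((j : ℝ) + 1) * δ) ω - N ((j : ℝ) * δ) ω) := by
      funext ω; rw [emGrid]
    have hcast : ((j + 1 : ℕ) : ℝ) * δ = ((j:ℝ) + 1) * δ := by push_cast; rfl
    rw [e, hcast]
    exact ((ih'.add ((hμ.comp ih').mul_const δ)).add ((hσ.comp ih').mul (w1.sub w0))).add
      ((hρ.comp ih').mul (n1.sub n0))

lemma grid_moment (F : Filtration ℝ m0) (P : Measure Ω) [IsProbabilityMeasure P]
    (T : ℝ) (W N : ℝ → Ω → ℝ)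
    (hW : ∀ t ∈ Set.Icc (0:ℝ) T, Measurable[F t] (W t))
    (hN : ∀ t ∈ Set.Icc (0:ℝ) T, Measurable[F t] (N t))
    (h_indep : ∀ s t : ℝ, 0 ≤ s → s ≤ t → t ≤ T →
      Indep (MeasurableSpace.comap (fun ω => (W t ω - W s ω, N t ω - N s ω)) inferInstance)
        (F s) P)
    (Λ : ℝ) (hΛ : 0 ≤ Λ)
    (hInc : ∀ s t : ℝ, 0 ≤ s → s ≤ t → t ≤ T → t - s ≤ 1 →
      Inc P (fun ω => W t ω - W s ω) (fun ω => N t ω - N s ω) (t - s) Λ)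
    (μ σ ρ : ℝ → ℝ) (hμ : Measurable μ) (hσ : Measurable σ) (hρ : Measurable ρ)
    (K : ℝ) (hK : 0 ≤ K) (gμ : ∀ y, |μ y| ≤ K * (1 + |y|)) (gσ : ∀ y, |σ y| ≤ K * (1 + |y|))
    (gρ : ∀ y, |ρ y| ≤ K * (1 + |y|))
    (δ : ℝ) (hδ : 0 < δ) (hδ1 : δ ≤ 1) (x : ℝ) (j : ℕ) (hj : (j:ℝ) * δ ≤ T) :
    ∫⁻ ω, ENNReal.ofReal (1 + emGrid μ σ ρ W N δ x j ω ^ 2) ∂P ≤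
      ENNReal.ofReal ((1 + 2 * (2 * K + K^2 + 2 * (1 + K) * K * Λ + 2 * K^2 * (1 + Λ)) * δ) ^ j
        * (1 + x ^ 2)) := by
  set c := 1 + 2 * (2 * K + K^2 + 2 * (1 + K) * K * Λ + 2 * K^2 * (1 + Λ)) * δ with hc
  have hc0 : 0 ≤ c := by positivity
  induction j with
  | zero => simp [emGrid]
  | succ j ih =>
    have hj' := hj
    push_cast at hj'
    have hle : (j:ℝ) * δ ≤ ((j:ℝ) + 1) * δ := by gcongr; linarith
    have h0 : 0 ≤ (j:ℝ) * δ := by positivity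
    have hd : ((j:ℝ) + 1) * δ - j * δ = δ := by ring
    have hYm := grid_meas F T W N hW hN μ σ ρ hμ hσ hρ δ hδ x j (hle.trans hj')
    have mW : ∀ t ∈ Set.Icc (0:ℝ) T, Measurable (W t) := fun t ht => (hW t ht).mono (F.le t) le_rfl
    have mN : ∀ t ∈ Set.Icc (0:ℝ) T, Measurable (N t) := fun t ht => (hN t ht).mono (F.le t) le_rfl
    have m1 : ((j:ℝ) + 1) * δ ∈ Set.Icc (0:ℝ) T := ⟨h0.trans hle, hj'⟩
    have m2 : (j:ℝ) * δ ∈ Set.Icc (0:ℝ) T := ⟨h0, hle.trans hj'⟩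
    have hinc := hInc _ _ h0 hle hj' (by rw [hd]; exact hδ1)
    rw [hd] at hinc
    have key := cond_bound (F (j * δ)) P (F.le _) (emGrid μ σ ρ W N δ x j)
      (fun ω => W (((j : ℝ) + 1) * δ) ω - W ((j : ℝ) * δ) ω)
      (fun ω => N (((j : ℝ) + 1) * δ) ω - N ((j : ℝ) * δ) ω) hYm
      ((mW _ m1).sub (mW _ m2)) ((mN _ m1).sub (mN _ m2)) (h_indep _ _ h0 hle hj')
      (fun y w v => ENNReal.ofReal (1 + (y + μ y * δ + σ y * w + ρ y * v) ^ 2))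
      (by fun_prop) (fun y => ENNReal.ofReal (c * (1 + y ^ 2))) (by fun_prop)
      (fun y => onestep_growth P _ _ δ Λ hδ.le hδ1 hΛ hinc K hK y _ _ _ (gμ y) (gσ y) (gρ y))
    have e : ∀ ω, emGrid μ σ ρ W N δ x (j+1) ω = emGrid μ σ ρ W N δ x j ω
        + μ (emGrid μ σ ρ W N δ x j ω) * δ
        + σ (emGrid μ σ ρ W N δ x j ω) * (W (((j : ℝ) + 1) * δ) ω - W ((j : ℝ) * δ) ω)
        + ρ (emGrid μ σ ρ W N δ x j ω) * (N (((j : ℝ) + 1) * δ) ω - N ((j : ℝ) * δ) ω) := by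
      intro ω; rw [emGrid]
    simp only [e]
    refine key.trans ?_
    simp only [ENNReal.ofReal_mul hc0]
    rw [lintegral_const_mul' _ _ ENNReal.ofReal_ne_top, pow_succ', mul_assoc,
      ENNReal.ofReal_mul hc0]
    gcongr
    exact ih (hle.trans hj')

lemma floor_facts (δ s : ℝ) (hδ : 0 < δ) (hs : 0 ≤ s) :
    ((⌊s / δ⌋.toNat : ℕ) : ℝ) * δ ≤ s ∧ s - ((⌊s / δ⌋.toNat : ℕ) : ℝ) * δ ≤ δ := by
  have hnn : 0 ≤ ⌊s / δ⌋ := Int.floor_nonneg.2 (by positivity)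
  have he : ((⌊s / δ⌋.toNat : ℕ) : ℝ) = (⌊s / δ⌋ : ℝ) := by
    rw [← Int.cast_natCast, Int.toNat_of_nonneg hnn]
  rw [he]
  have h1 := Int.floor_le (s / δ)
  have h2 := Int.lt_floor_add_one (s / δ)
  rw [le_div_iff₀ hδ] at h1
  rw [div_lt_iff₀ hδ] at h2
  exact ⟨h1, by linarith⟩

lemma proc_lastGrid (μ σ ρ : ℝ → ℝ) (W N : ℝ → Ω → ℝ) (δ x s : ℝ) (hδ : 0 < δ) (ω : Ω) :
    emProc μ σ ρ W N δ x (lastGrid δ s) ω = emGrid μ σ ρ W N δ x (⌊s / δ⌋.toNat) ω := by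
  have h1 : ⌊lastGrid δ s / δ⌋.toNat = ⌊s / δ⌋.toNat := by
    rw [lastGrid, mul_div_cancel_right₀ _ hδ.ne', Int.floor_natCast, Int.toNat_natCast]
  have h2 : lastGrid δ (lastGrid δ s) = lastGrid δ s := by
    conv_lhs => rw [lastGrid, h1]
    rfl
  rw [emProc, h1, h2]
  ring

end Scheme

end EMAux

/-- Estimate on the difference of the squared diffusion coefficient along the
Euler–Maruyama process and its grid values:
`E[∫_0^t |σ(X^{(δ),x}_s)² - σ(X^{(δ),x}_{s̲})²| ds] ≤ C (1 + x²) δ^{1/2}`. -/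
theorem em_sigma_squared_difference
    {Ω : Type*} {m0 : MeasurableSpace Ω}
    (F : Filtration ℝ m0) (P : Measure Ω) [IsProbabilityMeasure P]
    (T : ℝ) (hT : 0 < T)
    (lam : ℝ → ℝ) (hlam_meas : Measurable lam)
    (hlam_pos : ∀ t ∈ Set.Icc (0:ℝ) T, 0 < lam t)
    (lamB : ℝ) (hlamB : ∀ t ∈ Set.Icc (0:ℝ) T, lam t ≤ lamB)
    (W N : ℝ → Ω → ℝ)
    (hW0 : ∀ ω, W 0 ω = 0) (hN0 : ∀ ω, N 0 ω = 0)
    (hW_adapted : ∀ t ∈ Set.Icc (0:ℝ) T, Measurable[F t] (W t))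
    (hN_adapted : ∀ t ∈ Set.Icc (0:ℝ) T, Measurable[F t] (N t))
    (hW_cont : ∀ᵐ ω ∂P, ContinuousOn (fun t => W t ω) (Set.Icc 0 T))
    (hN_mono : ∀ᵐ ω ∂P, ∀ s t : ℝ, 0 ≤ s → s ≤ t → t ≤ T → N s ω ≤ N t ω)
    (hN_rc : ∀ᵐ ω ∂P, ∀ t ∈ Set.Ico (0:ℝ) T,
      Filter.Tendsto (fun u => N u ω) (nhdsWithin t (Set.Ioi t)) (nhds (N t ω)))
    (hN_int : ∀ᵐ ω ∂P, ∀ t ∈ Set.Icc (0:ℝ) T, ∃ k : ℕ, N t ω = k)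
    (hW_gauss : ∀ s t : ℝ, 0 ≤ s → s ≤ t → t ≤ T →
      Measure.map (fun ω => W t ω - W s ω) P = gaussianReal 0 (Real.toNNReal (t - s)))
    (hN_poisson : ∀ s t : ℝ, 0 ≤ s → s ≤ t → t ≤ T →
      Measure.map (fun ω => N t ω - N s ω) P
        = Measure.map (fun k : ℕ => (k : ℝ))
            (poissonMeasure (Real.toNNReal (∫ u in s..t, lam u))))
    (h_indep : ∀ s t : ℝ, 0 ≤ s → s ≤ t → t ≤ T →
      Indep (MeasurableSpace.comap (fun ω => (W t ω - W s ω, N t ω - N s ω)) inferInstance)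
        (F s) P)
    (hWN_indep : ∀ s t : ℝ, 0 ≤ s → s ≤ t → t ≤ T →
      IndepFun (fun ω => W t ω - W s ω) (fun ω => N t ω - N s ω) P)
    (μ σ ρ : ℝ → ℝ) (hμ_meas : Measurable μ) (hσ_meas : Measurable σ) (hρ_meas : Measurable ρ)
    (m : ℕ) (hm : 0 < m) (ζ : Fin m → ℝ) (hζ : StrictMono ζ)
    (hμ_low : ∃ K : NNReal, LipschitzOnWith K μ (Set.Iio (ζ ⟨0, hm⟩)))
    (hμ_high : ∃ K : NNReal, LipschitzOnWith K μ (Set.Ioi (ζ ⟨m - 1, Nat.sub_lt hm one_pos⟩)))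
    (hμ_mid : ∀ (k : Fin m) (h : (k : ℕ) + 1 < m),
      ∃ K : NNReal, LipschitzOnWith K μ (Set.Ioo (ζ k) (ζ ⟨(k : ℕ) + 1, h⟩)))
    (hσ_lip : ∃ K : NNReal, LipschitzWith K σ)
    (hσ_nz : ∀ k : Fin m, σ (ζ k) ≠ 0)
    (hρ_lip : ∃ K : NNReal, LipschitzWith K ρ)
    :
    ∃ C : ℝ, 0 < C ∧ ∀ (x : ℝ) (n : ℕ), 0 < n → T / n < 1 → ∀ t ∈ Set.Icc (0:ℝ) T,
      ∫⁻ ω, (∫⁻ s in Set.Icc (0:ℝ) t, ENNReal.ofReal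
          |σ (emProc μ σ ρ W N (T / n) x s ω) ^ 2
            - σ (emProc μ σ ρ W N (T / n) x (lastGrid (T / n) s) ω) ^ 2|) ∂P
        ≤ ENNReal.ofReal (C * (1 + x ^ 2) * Real.sqrt (T / n)) := by
  classical
  obtain ⟨K1, hK1⟩ := EMAux.pw_growth μ m hm ζ hμ_low hμ_high hμ_mid
  obtain ⟨L1, hL1⟩ := hσ_lip
  obtain ⟨L2, hL2⟩ := hρ_lip
  obtain ⟨K2, hK2⟩ := EMAux.lip_growth σ Set.univ ⟨L1, hL1.lipschitzOnWith⟩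
  obtain ⟨K3, hK3⟩ := EMAux.lip_growth ρ Set.univ ⟨L2, hL2.lipschitzOnWith⟩
  obtain ⟨K, hK, hKK1, hKK2, hKK3, hKL⟩ : ∃ K : ℝ, 0 ≤ K ∧ K1 ≤ K ∧ K2 ≤ K ∧ K3 ≤ K ∧ L1 ≤ K := by
    refine ⟨|K1| + |K2| + |K3| + L1, by positivity, ?_, ?_, ?_, ?_⟩ <;>
    linarith [le_abs_self K1, le_abs_self K2, le_abs_self K3, abs_nonneg K1, abs_nonneg K2,
      abs_nonneg K3, L1.2]
  have gμ : ∀ y, |μ y| ≤ K * (1 + |y|) := fun y => (hK1 y).trans (by gcongr)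
  have gσ : ∀ y, |σ y| ≤ K * (1 + |y|) := fun y => (hK2 y trivial).trans (by gcongr)
  have gρ : ∀ y, |ρ y| ≤ K * (1 + |y|) := fun y => (hK3 y trivial).trans (by gcongr)
  have lσ : ∀ x y, |σ x - σ y| ≤ K * |x - y| := fun x y => by
    have := hL1.dist_le_mul x y
    rw [Real.dist_eq, Real.dist_eq] at this
    exact this.trans (by gcongr)
  have mW : ∀ t ∈ Set.Icc (0:ℝ) T, Measurable (W t) :=
    fun t ht => (hW_adapted t ht).mono (F.le t) le_rfl
  have mN : ∀ t ∈ Set.Icc (0:ℝ) T, Measurable (N t) :=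
    fun t ht => (hN_adapted t ht).mono (F.le t) le_rfl
  have hlamB0 : 0 ≤ lamB :=
    (hlam_pos 0 ⟨le_rfl, hT.le⟩).le.trans (hlamB 0 ⟨le_rfl, hT.le⟩)
  obtain ⟨Λ, hΛ_def⟩ : ∃ Λ, Λ = lamB + lamB ^ 2 := ⟨_, rfl⟩
  have hΛ : 0 ≤ Λ := by rw [hΛ_def]; positivity
  have hInc : ∀ s t : ℝ, 0 ≤ s → s ≤ t → t ≤ T → t - s ≤ 1 →
      EMAux.Inc P (fun ω => W t ω - W s ω) (fun ω => N t ω - N s ω) (t - s) Λ := by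
    intro s t h0 h1 h2 h3
    rw [hΛ_def]
    have ms : s ∈ Set.Icc (0:ℝ) T := ⟨h0, h1.trans h2⟩
    have mt : t ∈ Set.Icc (0:ℝ) T := ⟨h0.trans h1, h2⟩
    refine EMAux.inc_of_laws P _ _ ((mW t mt).sub (mW s ms)) ((mN t mt).sub (mN s ms)) lam lamB
      s t h1 h3 (fun u hu => ?_) (hW_gauss s t h0 h1 h2) (hN_poisson s t h0 h1 h2)
    have hu' : u ∈ Set.Icc (0:ℝ) T := ⟨h0.trans hu.1, hu.2.trans h2⟩
    rw [abs_of_pos (hlam_pos u hu')]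
    exact hlamB u hu'
  obtain ⟨C1, hC1_def⟩ : ∃ C1, C1 = 2 * (2 * K + K^2 + 2 * (1 + K) * K * Λ + 2 * K^2 * (1 + Λ)) :=
    ⟨_, rfl⟩
  have hC1 : 0 ≤ C1 := by rw [hC1_def]; positivity
  obtain ⟨C2, hC2_def⟩ : ∃ C2, C2 = 2 * (2 * K^3 * (2 + Λ) + 3 * K^4 * (2 + Λ)) := ⟨_, rfl⟩
  have hC2 : 0 ≤ C2 := by rw [hC2_def]; positivity
  refine ⟨C2 * Real.exp (C1 * T) * T + 1, by positivity, ?_⟩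
  intro x n hn hn1 t ht
  obtain ⟨δ, hδ_def⟩ : ∃ δ, δ = T / n := ⟨_, rfl⟩
  rw [← hδ_def] at hn1 ⊢
  have hδ : 0 < δ := by rw [hδ_def]; positivity
  have hδ1 : δ ≤ 1 := hn1.le
  simp only [EMAux.proc_lastGrid μ σ ρ W N δ x _ hδ]
  have mem1 : ∀ s ∈ Set.Icc (0:ℝ) T, lastGrid δ s ∈ Set.Icc (0:ℝ) T := by
    intro s hs
    exact ⟨mul_nonneg (Nat.cast_nonneg _) hδ.le, (EMAux.floor_facts δ s hδ hs.1).1.trans hs.2⟩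
  have mY : ∀ s ∈ Set.Icc (0:ℝ) T, Measurable[F (lastGrid δ s)]
      (emGrid μ σ ρ W N δ x (⌊s / δ⌋.toNat)) := fun s hs =>
    EMAux.grid_meas F T W N hW_adapted hN_adapted μ σ ρ hμ_meas hσ_meas hρ_meas δ hδ x _
      (mem1 s hs).2
  have main := EMAux.fatou_swap P T hT
    (fun s ω => ENNReal.ofReal |σ (emProc μ σ ρ W N δ x s ω) ^ 2
            - σ (emGrid μ σ ρ W N δ x (⌊s / δ⌋.toNat) ω) ^ 2|) ?_ ?_
    (ENNReal.ofReal (C2 * Real.sqrt δ * (Real.exp (C1 * T) * (1 + x ^ 2)))) ?_ t ht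
  · refine main.trans ?_
    rw [← ENNReal.ofReal_mul (by positivity)]
    refine ENNReal.ofReal_le_ofReal ?_
    have ht0 := ht.1
    have htT := ht.2
    calc C2 * Real.sqrt δ * (Real.exp (C1 * T) * (1 + x ^ 2)) * t
        ≤ C2 * Real.sqrt δ * (Real.exp (C1 * T) * (1 + x ^ 2)) * T := by gcongr
      _ = (C2 * Real.exp (C1 * T) * T) * (1 + x ^ 2) * Real.sqrt δ := by ring
      _ ≤ _ := by gcongr; linarith
  · intro s hs
    have h1 := (mY s hs).mono (F.le _) le_rfl
    have h2 := mW s hs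
    have h3 := mW _ (mem1 s hs)
    have h4 := mN s hs
    have h5 := mN _ (mem1 s hs)
    unfold emProc
    fun_prop
  · filter_upwards [hW_cont, hN_rc] with ω hWω hNω
    intro s hs
    have hfl : ∀ᶠ u in nhdsWithin s (Set.Ioi s), ⌊u / δ⌋ = ⌊s / δ⌋ := by
      have h1 : Filter.Tendsto (fun u : ℝ => u / δ) (nhdsWithin s (Set.Ioi s))
          (nhdsWithin (s / δ) (Set.Ici (s / δ))) := by
        rw [tendsto_nhdsWithin_iff]
        refine ⟨((continuous_id.div_const δ).tendsto s).mono_left nhdsWithin_le_nhds, ?_⟩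
        filter_upwards [self_mem_nhdsWithin] with u hu
        exact div_le_div_of_nonneg_right (le_of_lt hu) hδ.le
      have h2 := (tendsto_floor_right_pure_floor (s / δ)).comp h1
      rw [Filter.tendsto_pure] at h2
      exact h2
    have hWs : Filter.Tendsto (fun u => W u ω) (nhdsWithin s (Set.Ioi s)) (nhds (W s ω)) := by
      have h1 := hWω s ⟨hs.1, hs.2.le⟩
      refine h1.mono_left ?_
      have h2 : Set.Ioo s T ⊆ Set.Icc 0 T := fun u hu => ⟨hs.1.trans hu.1.le, hu.2.le⟩
      rw [← nhdsWithin_Ioo_eq_nhdsGT hs.2]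
      exact nhdsWithin_mono _ h2
    have hNs := hNω s hs
    have hids : Filter.Tendsto (fun u : ℝ => u) (nhdsWithin s (Set.Ioi s)) (nhds s) :=
      nhdsWithin_le_nhds
    have hX : Filter.Tendsto (fun u => emGrid μ σ ρ W N δ x (⌊s / δ⌋.toNat) ω
        + μ (emGrid μ σ ρ W N δ x (⌊s / δ⌋.toNat) ω) * (u - lastGrid δ s)
        + σ (emGrid μ σ ρ W N δ x (⌊s / δ⌋.toNat) ω) * (W u ω - W (lastGrid δ s) ω)
        + ρ (emGrid μ σ ρ W N δ x (⌊s / δ⌋.toNat) ω) * (N u ω - N (lastGrid δ s) ω))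
        (nhdsWithin s (Set.Ioi s)) (nhds (emProc μ σ ρ W N δ x s ω)) :=
      (((hids.sub_const _).const_mul _).const_add _ |>.add
        ((hWs.sub_const _).const_mul _)).add ((hNs.sub_const _).const_mul _)
    have hY : Filter.Tendsto (fun u => ENNReal.ofReal |σ (emGrid μ σ ρ W N δ x (⌊s / δ⌋.toNat) ω
        + μ (emGrid μ σ ρ W N δ x (⌊s / δ⌋.toNat) ω) * (u - lastGrid δ s)
        + σ (emGrid μ σ ρ W N δ x (⌊s / δ⌋.toNat) ω) * (W u ω - W (lastGrid δ s) ω)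
        + ρ (emGrid μ σ ρ W N δ x (⌊s / δ⌋.toNat) ω) * (N u ω - N (lastGrid δ s) ω)) ^ 2
          - σ (emGrid μ σ ρ W N δ x (⌊s / δ⌋.toNat) ω) ^ 2|)
        (nhdsWithin s (Set.Ioi s)) (nhds (ENNReal.ofReal |σ (emProc μ σ ρ W N δ x s ω) ^ 2
            - σ (emGrid μ σ ρ W N δ x (⌊s / δ⌋.toNat) ω) ^ 2|)) :=
      ENNReal.tendsto_ofReal
        (((((hL1.continuous.tendsto _).comp hX).pow 2).sub_const _).abs)
    refine hY.congr' ?_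
    filter_upwards [hfl] with u hu
    simp only [emProc, lastGrid, hu]
  · intro s hs
    obtain ⟨f1, f2⟩ := EMAux.floor_facts δ s hδ hs.1
    have hl0 := (mem1 s hs).1
    have hl1 : lastGrid δ s ≤ s := f1
    have hl2 : s - lastGrid δ s ≤ δ := f2
    have hinc := hInc _ _ hl0 hl1 hs.2 (hl2.trans hδ1)
    have key := EMAux.cond_bound (F (lastGrid δ s)) P (F.le _)
      (emGrid μ σ ρ W N δ x (⌊s / δ⌋.toNat))
      (fun ω => W s ω - W (lastGrid δ s) ω) (fun ω => N s ω - N (lastGrid δ s) ω) (mY s hs)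
      ((mW s hs).sub (mW _ (mem1 s hs))) ((mN s hs).sub (mN _ (mem1 s hs)))
      (h_indep _ _ hl0 hl1 hs.2)
      (fun y w v => ENNReal.ofReal
        |σ (y + μ y * (s - lastGrid δ s) + σ y * w + ρ y * v) ^ 2 - σ y ^ 2|)
      (by fun_prop) (fun y => ENNReal.ofReal (C2 * Real.sqrt δ * (1 + y ^ 2))) (by fun_prop)
      (fun y => by
        rw [hC2_def]
        exact EMAux.onestep_diff P _ _ _ δ Λ (sub_nonneg.2 hl1) hl2 hδ hδ1 hΛ hinc K hK σ lσ
          y _ _ (gμ y) (gσ y) (gρ y))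
    refine key.trans ?_
    have hc0 : 0 ≤ C2 * Real.sqrt δ := by positivity
    simp only [ENNReal.ofReal_mul hc0]
    rw [lintegral_const_mul' _ _ ENNReal.ofReal_ne_top]
    gcongr
    refine (EMAux.grid_moment F P T W N hW_adapted hN_adapted h_indep Λ hΛ hInc μ σ ρ hμ_meas
      hσ_meas hρ_meas K hK gμ gσ gρ δ hδ hδ1 x _ (mem1 s hs).2).trans ?_
    refine ENNReal.ofReal_le_ofReal ?_
    rw [← hC1_def]
    gcongr
    calc (1 + C1 * δ) ^ (⌊s / δ⌋.toNat) ≤ (Real.exp (C1 * δ)) ^ (⌊s / δ⌋.toNat) := by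
          gcongr
          linarith [Real.add_one_le_exp (C1 * δ)]
      _ = Real.exp (C1 * (((⌊s / δ⌋.toNat : ℕ) : ℝ) * δ)) := by
          rw [← Real.exp_nat_mul]; ring_nf
      _ ≤ Real.exp (C1 * T) := by
          gcongr
          exact f1.trans hs.2
end

section
/- There exist a constant C_1 ∈ (0,∞) and δ_0 ∈ (0,1) such that for every n ∈ ℕ with δ = T/n ∈ (0,δ_0), every k ∈ {1,…,m}, and all s, t ∈ [0,T] with t̲ − s ≥ δ, it holds that P(Z_k^s ∩ Z_k^t) ≤ C_1 P(Z_k^s) δ + C_1 ∫_ℝ P( Z_k^s ∩ { |X^{(δ)}_{t̲−(t−t̲)} − ζ_k| ≤ C_1 δ^{1/2}(1 + |z|) } ) e^{−z^2/2} dz. -/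
open MeasureTheory ProbabilityTheory

/-- The event `Z_k^t` that the Euler–Maruyama process at times `t̲` and `t` lies on
different sides of the point `ζk` (i.e. `(X_t̲ - ζk)(X_t - ζk) ≤ 0`). -/
def crossEvent {Ω : Type*} (μ σ ρ : ℝ → ℝ) (W N : ℝ → Ω → ℝ)
    (δ x ζk t : ℝ) : Set Ω :=
  {ω | (emProc μ σ ρ W N δ x (lastGrid δ t) ω - ζk) * (emProc μ σ ρ W N δ x t ω - ζk) ≤ 0}

lemma emx_indep_int {Ω : Type*} (G : MeasurableSpace Ω) {m0 : MeasurableSpace Ω}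
    (P : Measure Ω) [IsProbabilityMeasure P] (hG : G ≤ m0) (D : Ω → ℝ) (hD : Measurable D)
    (hind : Indep (MeasurableSpace.comap D inferInstance) G P) (v : NNReal)
    (hlaw : Measure.map D P = gaussianReal 0 v) (A : Set Ω) (hA : MeasurableSet[G] A)
    (X : Ω → ℝ) (hX : Measurable[G] X) (z0 : ℝ) (r : ℝ → ℝ) (hr : Measurable r) :
    P (A ∩ {ω | |X ω - z0| ≤ r (D ω)})
      = ∫⁻ z, P (A ∩ {ω | |X ω - z0| ≤ r (Real.sqrt v * z)}) ∂(gaussianReal 0 1) := by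
  classical
  have hYG : Measurable[G] (fun ω => (A.indicator (fun _ => (1:ℝ)) ω, X ω)) :=
    Measurable.prodMk (Measurable.indicator measurable_const hA) hX
  set Y : Ω → ℝ × ℝ := fun ω => (A.indicator (fun _ => (1:ℝ)) ω, X ω) with hY
  have hYm : Measurable Y := hYG.mono hG le_rfl
  have hI : IndepFun D Y P := by
    rw [IndepFun_iff_Indep]
    exact indep_of_indep_of_le_right hind hYG.comap_le
  have hmap := (indepFun_iff_map_prod_eq_prod_map_map hD.aemeasurable hYm.aemeasurable).1 hI
  set S : Set (ℝ × (ℝ × ℝ)) := {p | p.2.1 = 1 ∧ |p.2.2 - z0| ≤ r p.1} with hS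
  have hSm : MeasurableSet S := by
    have s1 : MeasurableSet {p : ℝ × (ℝ × ℝ) | p.2.1 = 1} :=
      measurableSet_eq_fun (by fun_prop) (by fun_prop)
    have s2 : MeasurableSet {p : ℝ × (ℝ × ℝ) | |p.2.2 - z0| ≤ r p.1} :=
      measurableSet_le (by fun_prop) (by fun_prop)
    exact s1.inter s2
  have key : ∀ ω, Y ω ∈ {y : ℝ × ℝ | y.1 = 1} ↔ ω ∈ A := by
    intro ω
    by_cases h : ω ∈ A <;> simp [hY, h]
  have h1 : P (A ∩ {ω | |X ω - z0| ≤ r (D ω)}) = (Measure.map (fun ω => (D ω, Y ω)) P) S := by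
    rw [Measure.map_apply (hD.prodMk hYm) hSm]
    congr 1
    ext ω
    have := key ω
    simp only [Set.mem_inter_iff, Set.mem_ofPred_eq, Set.mem_preimage, hS] at this ⊢
    rw [this]
  have hscale : gaussianReal 0 v = Measure.map (fun z => Real.sqrt v * z) (gaussianReal 0 1) := by
    rw [gaussianReal_map_const_mul]
    congr 1
    · simp
    · ext; simp
  rw [h1, hmap, Measure.prod_apply hSm, hlaw, hscale,
    lintegral_map (measurable_measure_prodMk_left hSm) (by fun_prop)]
  refine lintegral_congr fun z => ?_
  rw [Measure.map_apply hYm (measurable_prodMk_left hSm)]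
  congr 1
  ext ω
  have := key ω
  simp only [Set.mem_inter_iff, Set.mem_ofPred_eq, Set.mem_preimage, hS] at this ⊢
  rw [this]

lemma emx_gauss_le (f : ℝ → ENNReal) :
    ∫⁻ z, f z ∂(gaussianReal 0 1) ≤ ∫⁻ z, f z * ENNReal.ofReal (Real.exp (-z ^ 2 / 2)) := by
  rw [gaussianReal_of_var_ne_zero 0 one_ne_zero]
  refine (lintegral_withDensity_le_lintegral_mul _ (by fun_prop) _).trans ?_
  refine lintegral_mono fun z => ?_
  simp only [Pi.mul_apply]
  rw [mul_comm]
  gcongr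
  unfold gaussianPDF
  apply ENNReal.ofReal_le_ofReal
  rw [gaussianPDFReal]
  have h1 : (Real.sqrt (2 * Real.pi * ((1 : NNReal) : ℝ)))⁻¹ ≤ 1 := by
    apply inv_le_one_of_one_le₀
    rw [Real.one_le_sqrt]
    have := Real.pi_gt_three
    simp; linarith
  have h2 : (-(z - 0) ^ 2 / (2 * ((1 : NNReal) : ℝ))) = -z ^ 2 / 2 := by simp
  rw [h2]
  exact mul_le_of_le_one_left (Real.exp_pos _).le h1

lemma emx_gauss_tail (v : NNReal) (c : ℝ) (hc : 0 < c) :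
    gaussianReal 0 v {x | c ≤ |x|} ≤ ENNReal.ofReal (v / c ^ 2) := by
  have := meas_ge_le_variance_div_sq (μ := gaussianReal 0 v) (X := id)
    (memLp_id_gaussianReal 2) hc
  simpa [variance_id_gaussianReal] using this

lemma emx_poisson (r : NNReal) :
    Measure.map (fun k : ℕ => (k : ℝ)) (poissonMeasure r) {x | x ≠ 0} ≤ ENNReal.ofReal r := by
  rw [Measure.map_apply (by fun_prop) (by measurability)]
  have : (fun k : ℕ => (k : ℝ)) ⁻¹' {x | x ≠ 0} = ({0} : Set ℕ)ᶜ := by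
    ext; simp
  rw [this, prob_compl_eq_one_sub (by measurability), poissonMeasure_singleton]
  simp only [pow_zero, mul_one, Nat.factorial_zero, Nat.cast_one, div_one]
  rw [← ENNReal.ofReal_one, ← ENNReal.ofReal_sub _ (Real.exp_pos _).le]
  apply ENNReal.ofReal_le_ofReal
  have := Real.add_one_le_exp (-(r:ℝ))
  linarith

/-- deterministic estimate -/
lemma emx_det (K v x y e0 e1 e2 : ℝ) (hK : 1 ≤ K) (hv : 0 ≤ v) (hx : 0 ≤ x) (hy : 0 ≤ y)
    (he1 : 0 ≤ e1)
    (h0 : K * e0 ≤ 1/4) (h1 : K * e1 ≤ 1/4) (h2 : K * e2 ≤ 1/4)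
    (hyy : y ≤ K * (1 + y) * e2) (hvv : v ≤ x + K * (1 + v) * e0)
    (hxx : x ≤ y + K * (1 + v) * e1) : x ≤ 4 * K * (e1 + e2) := by
  have a1 : y ≤ 2 * (K * e2) := by nlinarith
  have a2 : v ≤ 2 * x + 1 := by nlinarith
  have a3 : (1 + v) * (K * e1) ≤ (2 + 2 * x) * (K * e1) := by
    apply mul_le_mul_of_nonneg_right _ (by positivity); linarith
  have a4 : x * (K * e1) ≤ x * (1/4) := mul_le_mul_of_nonneg_left h1 hx
  nlinarith

lemma emx_lip_growth (f : ℝ → ℝ) (S : Set ℝ) (h : ∃ K : NNReal, LipschitzOnWith K f S) :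
    ∃ K : ℝ, 0 ≤ K ∧ ∀ x ∈ S, |f x| ≤ K * (1 + |x|) := by
  obtain ⟨K, hK⟩ := h
  rcases S.eq_empty_or_nonempty with rfl | ⟨a, ha⟩
  · exact ⟨0, le_rfl, by simp⟩
  · refine ⟨K + K * |a| + |f a|, by positivity, fun x hx => ?_⟩
    have h1 := hK.dist_le_mul x hx a ha
    rw [Real.dist_eq, Real.dist_eq] at h1
    have h2 : |x - a| ≤ |x| + |a| := abs_sub _ _
    have h3 : |f x| ≤ |f x - f a| + |f a| := by
      have := abs_add_le (f x - f a) (f a); simpa using this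
    have h4 : (K:ℝ) * |x - a| ≤ K * (|x| + |a|) := by gcongr
    have : 0 ≤ (K * |a| + |f a|) * |x| := by positivity
    have : (0:ℝ) ≤ K := K.2
    nlinarith

lemma emx_growth_union (f : ℝ → ℝ) (S S' : Set ℝ)
    (h : ∃ K : ℝ, 0 ≤ K ∧ ∀ x ∈ S, |f x| ≤ K * (1 + |x|))
    (h' : ∃ K : ℝ, 0 ≤ K ∧ ∀ x ∈ S', |f x| ≤ K * (1 + |x|)) :
    ∃ K : ℝ, 0 ≤ K ∧ ∀ x ∈ S ∪ S', |f x| ≤ K * (1 + |x|) := by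
  obtain ⟨K, hK, h⟩ := h
  obtain ⟨K', hK', h'⟩ := h'
  refine ⟨K + K', by positivity, fun x hx => ?_⟩
  have := abs_nonneg x
  rcases hx with hx | hx
  · have := h x hx; nlinarith
  · have := h' x hx; nlinarith

lemma emx_mu_growth (μ : ℝ → ℝ) (m : ℕ) (hm : 0 < m) (ζ : Fin m → ℝ)
    (hμ_low : ∃ K : NNReal, LipschitzOnWith K μ (Set.Iio (ζ ⟨0, hm⟩)))
    (hμ_high : ∃ K : NNReal, LipschitzOnWith K μ (Set.Ioi (ζ ⟨m - 1, Nat.sub_lt hm one_pos⟩)))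
    (hμ_mid : ∀ (k : Fin m) (h : (k : ℕ) + 1 < m),
      ∃ K : NNReal, LipschitzOnWith K μ (Set.Ioo (ζ k) (ζ ⟨(k : ℕ) + 1, h⟩))) :
    ∃ K : ℝ, 0 ≤ K ∧ ∀ x, |μ x| ≤ K * (1 + |x|) := by
  have hsing : ∀ a : ℝ, ∃ K : ℝ, 0 ≤ K ∧ ∀ x ∈ ({a} : Set ℝ), |μ x| ≤ K * (1 + |x|) := by
    intro a
    refine ⟨|μ a|, abs_nonneg _, ?_⟩
    rintro x rfl
    have := mul_nonneg (abs_nonneg (μ x)) (abs_nonneg x)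
    linarith
  have hind : ∀ i (hi : i < m), ∃ K : ℝ, 0 ≤ K ∧ ∀ x ∈ Set.Iic (ζ ⟨i, hi⟩),
      |μ x| ≤ K * (1 + |x|) := by
    intro i
    induction i with
    | zero =>
      intro hi
      obtain ⟨K, hK, h⟩ := emx_growth_union μ _ _ (emx_lip_growth μ _ hμ_low) (hsing (ζ ⟨0, hm⟩))
      exact ⟨K, hK, fun x hx => h x (by
        rcases lt_or_eq_of_le (Set.mem_Iic.1 hx) with h | h
        · exact Or.inl h
        · exact Or.inr h)⟩
    | succ i ih =>
      intro hi
      obtain ⟨K, hK, h⟩ := emx_growth_union μ _ _ (ih (by omega))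
        (emx_growth_union μ _ _ (emx_lip_growth μ _ (hμ_mid ⟨i, by omega⟩ hi)) (hsing (ζ ⟨i+1, hi⟩)))
      refine ⟨K, hK, fun x hx => h x ?_⟩
      by_cases h1 : x ≤ ζ ⟨i, by omega⟩
      · exact Or.inl h1
      · right
        rcases lt_or_eq_of_le (Set.mem_Iic.1 hx) with h | h
        · exact Or.inl ⟨not_le.1 h1, h⟩
        · exact Or.inr h
  obtain ⟨K, hK, h⟩ := emx_growth_union μ _ _ (hind (m-1) (by omega)) (emx_lip_growth μ _ hμ_high)
  refine ⟨K, hK, fun x => h x ?_⟩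
  rcases le_or_gt x (ζ ⟨m - 1, by omega⟩) with h | h
  · exact Or.inl h
  · exact Or.inr h

/-- linear growth centered at `a` -/
lemma emx_center (f : ℝ → ℝ) (K M a : ℝ) (hK : 0 ≤ K) (ha : |a| ≤ M)
    (h : ∀ x, |f x| ≤ K * (1 + |x|)) (x : ℝ) : |f x| ≤ K * (1 + M) * (1 + |x - a|) := by
  have h1 := h x
  have h2 : |x| ≤ |x - a| + |a| := by
    have := abs_add_le (x - a) a; simpa using this
  have h3 : K * (1 + |x|) ≤ K * (1 + (|x - a| + M)) := by gcongr; linarith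
  have h4 : 0 ≤ K * (M * |x - a|) := by
    have := (abs_nonneg a).trans ha; positivity
  nlinarith

lemma emx_floor_eq (δ u : ℝ) (hδ : 0 < δ) (j : ℕ) (h1 : (j:ℝ) * δ ≤ u) (h2 : u < ((j:ℝ) + 1) * δ) :
    ⌊u / δ⌋.toNat = j := by
  have : ⌊u / δ⌋ = (j : ℤ) := by
    rw [Int.floor_eq_iff]
    constructor
    · rw [le_div_iff₀ hδ]; exact_mod_cast h1
    · rw [div_lt_iff₀ hδ]; exact_mod_cast h2
  rw [this]; simp

lemma emx_lastGrid_spec (δ t : ℝ) (hδ : 0 < δ) (ht : 0 ≤ t) :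
    lastGrid δ t ≤ t ∧ t < lastGrid δ t + δ := by
  have h0 : 0 ≤ ⌊t / δ⌋ := Int.floor_nonneg.2 (by positivity)
  have h1 : ((⌊t / δ⌋.toNat : ℕ) : ℝ) = (⌊t / δ⌋ : ℝ) := by
    exact_mod_cast Int.toNat_of_nonneg h0
  unfold lastGrid
  rw [h1]
  constructor
  · have := Int.floor_le (t / δ)
    rwa [le_div_iff₀ hδ] at this
  · have := Int.lt_floor_add_one (t / δ)
    rw [div_lt_iff₀ hδ] at this
    linarith

lemma emx_grid_meas {Ω : Type*} {m0 : MeasurableSpace Ω} (F : Filtration ℝ m0) (T : ℝ)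
    (W N : ℝ → Ω → ℝ)
    (hW : ∀ t ∈ Set.Icc (0:ℝ) T, Measurable[F t] (W t))
    (hN : ∀ t ∈ Set.Icc (0:ℝ) T, Measurable[F t] (N t))
    (μ σ ρ : ℝ → ℝ) (hμ : Measurable μ) (hσ : Measurable σ) (hρ : Measurable ρ)
    (δ x : ℝ) (hδ : 0 < δ) (j : ℕ) :
    (j:ℝ) * δ ≤ T → Measurable[F ((j:ℝ) * δ)] (emGrid μ σ ρ W N δ x j) := by
  induction j with
  | zero => intro _; exact measurable_const
  | succ j ih =>
    intro hj
    have ec : ((j + 1 : ℕ) : ℝ) = (j:ℝ) + 1 := by push_cast; ring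
    rw [ec] at hj ⊢
    have hle : (j:ℝ) * δ ≤ ((j:ℝ) + 1) * δ := by nlinarith
    have h0 : 0 ≤ (j:ℝ) * δ := by positivity
    have hg : Measurable[F (((j:ℝ) + 1) * δ)] (emGrid μ σ ρ W N δ x j) :=
      (ih (hle.trans hj)).mono (F.mono hle) le_rfl
    have hW1 := hW _ ⟨h0.trans hle, hj⟩
    have hN1 := hN _ ⟨h0.trans hle, hj⟩
    have hW2 := (hW _ ⟨h0, hle.trans hj⟩).mono (F.mono hle) le_rfl
    have hN2 := (hN _ ⟨h0, hle.trans hj⟩).mono (F.mono hle) le_rfl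
    have e : emGrid μ σ ρ W N δ x (j+1) = fun ω => emGrid μ σ ρ W N δ x j ω
        + μ (emGrid μ σ ρ W N δ x j ω) * δ
        + σ (emGrid μ σ ρ W N δ x j ω) * (W (((j : ℝ) + 1) * δ) ω - W ((j : ℝ) * δ) ω)
        + ρ (emGrid μ σ ρ W N δ x j ω) * (N (((j : ℝ) + 1) * δ) ω - N ((j : ℝ) * δ) ω) := by
      funext ω; rfl
    rw [e]
    exact ((hg.add ((hμ.comp hg).mul_const _)).add ((hσ.comp hg).mul (hW1.sub hW2))).add
      ((hρ.comp hg).mul (hN1.sub hN2))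

lemma emx_proc_meas {Ω : Type*} {m0 : MeasurableSpace Ω} (F : Filtration ℝ m0) (T : ℝ)
    (W N : ℝ → Ω → ℝ)
    (hW : ∀ t ∈ Set.Icc (0:ℝ) T, Measurable[F t] (W t))
    (hN : ∀ t ∈ Set.Icc (0:ℝ) T, Measurable[F t] (N t))
    (μ σ ρ : ℝ → ℝ) (hμ : Measurable μ) (hσ : Measurable σ) (hρ : Measurable ρ)
    (δ x : ℝ) (hδ : 0 < δ) (t : ℝ) (ht : t ∈ Set.Icc (0:ℝ) T) :
    Measurable[F t] (emProc μ σ ρ W N δ x t) := by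
  obtain ⟨hle, -⟩ := emx_lastGrid_spec δ t hδ ht.1
  have h0 : 0 ≤ lastGrid δ t := by unfold lastGrid; positivity
  have hg : Measurable[F t] (emGrid μ σ ρ W N δ x (⌊t / δ⌋.toNat)) :=
    (emx_grid_meas F T W N hW hN μ σ ρ hμ hσ hρ δ x hδ _ (hle.trans ht.2)).mono (F.mono hle) le_rfl
  have hW1 := hW _ ht
  have hN1 := hN _ ht
  have hW2 := (hW _ ⟨h0, hle.trans ht.2⟩).mono (F.mono hle) le_rfl
  have hN2 := (hN _ ⟨h0, hle.trans ht.2⟩).mono (F.mono hle) le_rfl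
  exact ((hg.add ((hμ.comp hg).mul_const _)).add ((hσ.comp hg).mul (hW1.sub hW2))).add
      ((hρ.comp hg).mul (hN1.sub hN2))

lemma emx_cross_meas {Ω : Type*} {m0 : MeasurableSpace Ω} (F : Filtration ℝ m0) (T : ℝ)
    (W N : ℝ → Ω → ℝ)
    (hW : ∀ t ∈ Set.Icc (0:ℝ) T, Measurable[F t] (W t))
    (hN : ∀ t ∈ Set.Icc (0:ℝ) T, Measurable[F t] (N t))
    (μ σ ρ : ℝ → ℝ) (hμ : Measurable μ) (hσ : Measurable σ) (hρ : Measurable ρ)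
    (δ x z : ℝ) (hδ : 0 < δ) (t : ℝ) (ht : t ∈ Set.Icc (0:ℝ) T) :
    MeasurableSet[F t] (crossEvent μ σ ρ W N δ x z t) := by
  obtain ⟨hle, -⟩ := emx_lastGrid_spec δ t hδ ht.1
  have h0 : 0 ≤ lastGrid δ t := by unfold lastGrid; positivity
  have h1 := emx_proc_meas F T W N hW hN μ σ ρ hμ hσ hρ δ x hδ t ht
  have h2 := (emx_proc_meas F T W N hW hN μ σ ρ hμ hσ hρ δ x hδ _ ⟨h0, hle.trans ht.2⟩).mono
    (F.mono hle) le_rfl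
  exact ((h2.sub_const z).mul (h1.sub_const z)) measurableSet_Iic

lemma emx_path {Ω : Type*} (μ σ ρ : ℝ → ℝ) (W N : ℝ → Ω → ℝ) (δ x z K : ℝ) (hδ : 0 < δ)
    (hK : 1 ≤ K) (hμ : ∀ y, |μ y| ≤ K * (1 + |y - z|)) (hσ : ∀ y, |σ y| ≤ K * (1 + |y - z|))
    (hδK : δ ≤ 1 / (8 * K)) (t a b u : ℝ) (j : ℕ) (ha : a = j * δ) (hb : b = ((j:ℝ) + 1) * δ)
    (hu : u = b - (t - b)) (hbt : b ≤ t) (htb : t < b + δ) (ω : Ω)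
    (hN0 : N u ω = N a ω) (hN1 : N b ω = N u ω) (hN2 : N t ω = N b ω)
    (hW0 : |W u ω - W a ω| ≤ 1 / (8 * K)) (hW1 : |W b ω - W u ω| ≤ 1 / (8 * K))
    (hW2 : |W t ω - W b ω| ≤ 1 / (8 * K))
    (hω : ω ∈ crossEvent μ σ ρ W N δ x z t) :
    |emProc μ σ ρ W N δ x u ω - z|
      ≤ 8 * K * ((t - b) + |W b ω - W u ω| + |W t ω - W b ω|) := by
  have hft : ⌊t / δ⌋.toNat = j + 1 :=
    emx_floor_eq δ t hδ _ (by push_cast; linarith) (by push_cast; linarith)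
  have hlt : lastGrid δ t = b := by unfold lastGrid; rw [hft, hb]; push_cast; ring
  have hfb : ⌊b / δ⌋.toNat = j + 1 :=
    emx_floor_eq δ b hδ _ (by push_cast; linarith) (by push_cast; linarith)
  have hlb : lastGrid δ b = b := by unfold lastGrid; rw [hfb, hb]; push_cast; ring
  set Xb := emGrid μ σ ρ W N δ x (j+1) ω with hXb
  have hpb : emProc μ σ ρ W N δ x b ω = Xb := by
    unfold emProc; rw [hlb, hfb]; simp [hXb]
  have hpt : emProc μ σ ρ W N δ x t ω = Xb + μ Xb * (t - b) + σ Xb * (W t ω - W b ω) := by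
    unfold emProc; rw [hlt, hft, hN2]; simp [hXb]
  have hcr : (Xb - z) * (emProc μ σ ρ W N δ x t ω - z) ≤ 0 := by
    have : (emProc μ σ ρ W N δ x (lastGrid δ t) ω - z) * (emProc μ σ ρ W N δ x t ω - z) ≤ 0 := hω
    rwa [hlt, hpb] at this
  have hK0 : 0 < K := by linarith
  rcases hbt.eq_or_lt with hbt' | hbt'
  · have hub : u = b := by rw [hu]; linarith
    rw [hub, hpb]
    rw [hpt, ← hbt'] at hcr
    have : Xb - z = 0 := by nlinarith
    rw [this, abs_zero]
    have := sub_nonneg.2 hbt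
    positivity
  · have hfu : ⌊u / δ⌋.toNat = j :=
      emx_floor_eq δ u hδ _ (by linarith) (by linarith)
    have hlu : lastGrid δ u = a := by unfold lastGrid; rw [hfu, ha]
    set Xa := emGrid μ σ ρ W N δ x j ω with hXa
    have hpu : emProc μ σ ρ W N δ x u ω = Xa + μ Xa * (u - a) + σ Xa * (W u ω - W a ω) := by
      unfold emProc; rw [hlu, hfu, hN0]; simp [hXa]
    set Xu := emProc μ σ ρ W N δ x u ω with hXu
    have hXb' : Xb = Xa + μ Xa * δ + σ Xa * (W b ω - W a ω) := by
      have : Xb = Xa + μ Xa * δ + σ Xa * (W (((j : ℝ) + 1) * δ) ω - W ((j : ℝ) * δ) ω)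
        + ρ Xa * (N (((j : ℝ) + 1) * δ) ω - N ((j : ℝ) * δ) ω) := rfl
      rw [this, ← ha, ← hb, hN1, hN0]; simp
    have hgen : ∀ (y d w : ℝ), 0 ≤ d →
        |μ y * d + σ y * w| ≤ K * (1 + |y - z|) * (d + |w|) := by
      intro y d w hd
      calc |μ y * d + σ y * w| ≤ |μ y * d| + |σ y * w| := abs_add_le _ _
        _ = |μ y| * d + |σ y| * |w| := by rw [abs_mul, abs_mul, abs_of_nonneg hd]
        _ ≤ K * (1 + |y - z|) * d + K * (1 + |y - z|) * |w| := by
            gcongr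
            · exact hμ y
            · exact hσ y
        _ = _ := by ring
    have hsm : ∀ d w : ℝ, d ≤ 1 / (8 * K) → w ≤ 1 / (8 * K) → K * (d + w) ≤ 1 / 4 := by
      intro d w h1 h2
      have : K * (d + w) ≤ K * (1 / (8 * K) + 1 / (8 * K)) := by gcongr
      have h3 : K * (1 / (8 * K) + 1 / (8 * K)) = 1 / 4 := by field_simp; norm_num
      linarith
    have hau : 0 ≤ u - a := by linarith
    have htb0 : 0 ≤ t - b := by linarith
    have g0 := hgen Xa (u - a) (W u ω - W a ω) hau
    have g1 := hgen Xa (t - b) (W b ω - W u ω) htb0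
    have g2 := hgen Xb (t - b) (W t ω - W b ω) htb0
    have e1 : |Xb - z| ≤ |μ Xb * (t - b) + σ Xb * (W t ω - W b ω)| := by
      have : emProc μ σ ρ W N δ x t ω - z
          = (Xb - z) + (μ Xb * (t - b) + σ Xb * (W t ω - W b ω)) := by rw [hpt]; ring
      rw [this] at hcr
      rw [← sq_le_sq]
      generalize μ Xb * (t - b) + σ Xb * (W t ω - W b ω) = q at *
      nlinarith [sq_nonneg (Xb - z + q)]
    have e2 : |Xa - z| ≤ |Xu - z| + |μ Xa * (u - a) + σ Xa * (W u ω - W a ω)| := by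
      have : Xa - z = (Xu - z) - (μ Xa * (u - a) + σ Xa * (W u ω - W a ω)) := by rw [hpu]; ring
      rw [this]; exact abs_sub _ _
    have e3 : |Xu - z| ≤ |Xb - z| + |μ Xa * (t - b) + σ Xa * (W b ω - W u ω)| := by
      have h' : δ = (u - a) + (t - b) := by rw [hu, ha, hb]; ring
      have : Xu - z = (Xb - z) - (μ Xa * (t - b) + σ Xa * (W b ω - W u ω)) := by
        rw [hpu, hXb', h']; ring
      rw [this]; exact abs_sub _ _
    have := emx_det K |Xa - z| |Xu - z| |Xb - z| (u - a + |W u ω - W a ω|)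
      (t - b + |W b ω - W u ω|) (t - b + |W t ω - W b ω|) hK (abs_nonneg _) (abs_nonneg _)
      (abs_nonneg _) (by positivity)
      (hsm _ _ (by linarith) hW0) (hsm _ _ (by linarith) hW1) (hsm _ _ (by linarith) hW2)
      (e1.trans g2) (e2.trans (by linarith)) (e3.trans (by linarith))
    refine this.trans ?_
    have p1 : 0 ≤ K * |W b ω - W u ω| := by positivity
    have p2 : 0 ≤ K * |W t ω - W b ω| := by positivity
    have p3 : 8 * K * ((t - b) + |W b ω - W u ω| + |W t ω - W b ω|)
        - 4 * K * (t - b + |W b ω - W u ω| + (t - b + |W t ω - W b ω|))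
        = 4 * (K * |W b ω - W u ω|) + 4 * (K * |W t ω - W b ω|) := by ring
    linarith

lemma emx_bad {Ω : Type*} {m0 : MeasurableSpace Ω}
    (F : Filtration ℝ m0) (P : Measure Ω) [IsProbabilityMeasure P]
    (T : ℝ) (lam : ℝ → ℝ)
    (hlam_pos : ∀ t ∈ Set.Icc (0:ℝ) T, 0 < lam t)
    (lamB : ℝ) (hlamB : ∀ t ∈ Set.Icc (0:ℝ) T, lam t ≤ lamB)
    (W N : ℝ → Ω → ℝ)
    (hW_adapted : ∀ t ∈ Set.Icc (0:ℝ) T, Measurable[F t] (W t))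
    (hN_adapted : ∀ t ∈ Set.Icc (0:ℝ) T, Measurable[F t] (N t))
    (hW_gauss : ∀ s t : ℝ, 0 ≤ s → s ≤ t → t ≤ T →
      Measure.map (fun ω => W t ω - W s ω) P = gaussianReal 0 (Real.toNNReal (t - s)))
    (hN_poisson : ∀ s t : ℝ, 0 ≤ s → s ≤ t → t ≤ T →
      Measure.map (fun ω => N t ω - N s ω) P
        = Measure.map (fun k : ℕ => (k : ℝ))
            (poissonMeasure (Real.toNNReal (∫ u in s..t, lam u))))
    (h_indep : ∀ s t : ℝ, 0 ≤ s → s ≤ t → t ≤ T →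
      Indep (MeasurableSpace.comap (fun ω => (W t ω - W s ω, N t ω - N s ω)) inferInstance)
        (F s) P)
    (hlam0 : 0 ≤ lamB) (c δ h h' : ℝ) (hc : 0 < c) (hh : 0 ≤ h) (hhh : h ≤ h') (hT : h' ≤ T)
    (hd : h' - h ≤ δ) (A : Set Ω) (hA : MeasurableSet[F h] A) :
    P (A ∩ {ω | N h' ω ≠ N h ω ∨ c < |W h' ω - W h ω|})
      ≤ ENNReal.ofReal ((lamB + 1 / c ^ 2) * δ) * P A := by
  have hWm : Measurable (fun ω => W h' ω - W h ω) :=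
    ((hW_adapted h' ⟨hh.trans hhh, hT⟩).mono (F.le _) le_rfl).sub
      ((hW_adapted h ⟨hh, hhh.trans hT⟩).mono (F.le _) le_rfl)
  have hNm : Measurable (fun ω => N h' ω - N h ω) :=
    ((hN_adapted h' ⟨hh.trans hhh, hT⟩).mono (F.le _) le_rfl).sub
      ((hN_adapted h ⟨hh, hhh.trans hT⟩).mono (F.le _) le_rfl)
  set S : Set (ℝ × ℝ) := {p | p.2 ≠ 0 ∨ c ≤ |p.1|} with hS
  have hSm : MeasurableSet S := by
    have s1 : MeasurableSet {p : ℝ × ℝ | p.2 = 0} :=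
      measurableSet_eq_fun (by fun_prop) (by fun_prop)
    have s2 : MeasurableSet {p : ℝ × ℝ | c ≤ |p.1|} :=
      measurableSet_le (by fun_prop) (by fun_prop)
    exact s1.compl.union s2
  set B : Set Ω := (fun ω => (W h' ω - W h ω, N h' ω - N h ω)) ⁻¹' S with hB
  have hind := (Indep_iff _ _ _).1 (h_indep h h' hh hhh hT) B A ⟨S, hSm, rfl⟩ hA
  have hsub : A ∩ {ω | N h' ω ≠ N h ω ∨ c < |W h' ω - W h ω|} ⊆ B ∩ A := by
    rintro ω ⟨h1, h2⟩
    refine ⟨?_, h1⟩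
    rcases h2 with h2 | h2
    · left; exact sub_ne_zero.2 h2
    · right; exact h2.le
  refine (measure_mono hsub).trans ?_
  rw [hind]
  gcongr
  have hBle : B ⊆ (fun ω => N h' ω - N h ω) ⁻¹' {x | x ≠ 0}
      ∪ (fun ω => W h' ω - W h ω) ⁻¹' {x | c ≤ |x|} := by
    rintro ω (h | h)
    · exact Or.inl h
    · exact Or.inr h
  have hδ0 : 0 ≤ δ := by linarith
  refine (measure_mono hBle).trans ((measure_union_le _ _).trans ?_)
  have m1 : MeasurableSet {x : ℝ | x ≠ 0} := (measurableSet_singleton (0:ℝ)).compl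
  have m2 : MeasurableSet {x : ℝ | c ≤ |x|} := measurableSet_le (by fun_prop) (by fun_prop)
  rw [← Measure.map_apply hNm m1, ← Measure.map_apply hWm m2,
    hW_gauss h h' hh hhh hT, hN_poisson h h' hh hhh hT, add_mul,
    ENNReal.ofReal_add (by positivity) (by positivity)]
  have hint : (∫ u in h..h', lam u) ≤ lamB * δ := by
    have := intervalIntegral.norm_integral_le_of_norm_le_const (f := lam) (a := h) (b := h')
      (C := lamB) (by
        intro x hx
        rw [Set.uIoc_of_le hhh] at hx
        have hx' : x ∈ Set.Icc (0:ℝ) T := ⟨by linarith [hx.1], by linarith [hx.2]⟩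
        rw [Real.norm_eq_abs, abs_of_pos (hlam_pos x hx')]
        exact hlamB x hx')
    have h2 := (le_abs_self _).trans this
    rw [abs_of_nonneg (sub_nonneg.2 hhh)] at h2
    exact h2.trans (by gcongr)
  gcongr
  · refine (emx_poisson _).trans (ENNReal.ofReal_le_ofReal ?_)
    rw [Real.coe_toNNReal']
    exact max_le hint (by positivity)
  · refine (emx_gauss_tail _ c hc).trans (ENNReal.ofReal_le_ofReal ?_)
    rw [Real.coe_toNNReal _ (sub_nonneg.2 hhh), div_eq_inv_mul, one_div]
    gcongr

/-- Crossing probability recursion: for `t̲ - s ≥ δ`,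
`P(Z_k^s ∩ Z_k^t) ≤ C₁ P(Z_k^s) δ
  + C₁ ∫_ℝ P(Z_k^s ∩ {|X^{(δ)}_{t̲-(t-t̲)} - ζ_k| ≤ C₁ δ^{1/2}(1+|z|)}) e^{-z²/2} dz`. -/
theorem em_crossing_probability_recursion
    {Ω : Type*} {m0 : MeasurableSpace Ω}
    (F : Filtration ℝ m0) (P : Measure Ω) [IsProbabilityMeasure P]
    (T : ℝ) (hT : 0 < T)
    (lam : ℝ → ℝ) (hlam_meas : Measurable lam)
    (hlam_pos : ∀ t ∈ Set.Icc (0:ℝ) T, 0 < lam t)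
    (lamB : ℝ) (hlamB : ∀ t ∈ Set.Icc (0:ℝ) T, lam t ≤ lamB)
    (W N : ℝ → Ω → ℝ)
    (hW0 : ∀ ω, W 0 ω = 0) (hN0 : ∀ ω, N 0 ω = 0)
    (hW_adapted : ∀ t ∈ Set.Icc (0:ℝ) T, Measurable[F t] (W t))
    (hN_adapted : ∀ t ∈ Set.Icc (0:ℝ) T, Measurable[F t] (N t))
    (hW_cont : ∀ᵐ ω ∂P, ContinuousOn (fun t => W t ω) (Set.Icc 0 T))
    (hN_mono : ∀ᵐ ω ∂P, ∀ s t : ℝ, 0 ≤ s → s ≤ t → t ≤ T → N s ω ≤ N t ω)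
    (hN_rc : ∀ᵐ ω ∂P, ∀ t ∈ Set.Ico (0:ℝ) T,
      Filter.Tendsto (fun u => N u ω) (nhdsWithin t (Set.Ioi t)) (nhds (N t ω)))
    (hN_int : ∀ᵐ ω ∂P, ∀ t ∈ Set.Icc (0:ℝ) T, ∃ k : ℕ, N t ω = k)
    (hW_gauss : ∀ s t : ℝ, 0 ≤ s → s ≤ t → t ≤ T →
      Measure.map (fun ω => W t ω - W s ω) P = gaussianReal 0 (Real.toNNReal (t - s)))
    (hN_poisson : ∀ s t : ℝ, 0 ≤ s → s ≤ t → t ≤ T →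
      Measure.map (fun ω => N t ω - N s ω) P
        = Measure.map (fun k : ℕ => (k : ℝ))
            (poissonMeasure (Real.toNNReal (∫ u in s..t, lam u))))
    (h_indep : ∀ s t : ℝ, 0 ≤ s → s ≤ t → t ≤ T →
      Indep (MeasurableSpace.comap (fun ω => (W t ω - W s ω, N t ω - N s ω)) inferInstance)
        (F s) P)
    (hWN_indep : ∀ s t : ℝ, 0 ≤ s → s ≤ t → t ≤ T →
      IndepFun (fun ω => W t ω - W s ω) (fun ω => N t ω - N s ω) P)
    (μ σ ρ : ℝ → ℝ) (hμ_meas : Measurable μ) (hσ_meas : Measurable σ) (hρ_meas : Measurable ρ)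
    (m : ℕ) (hm : 0 < m) (ζ : Fin m → ℝ) (hζ : StrictMono ζ)
    (hμ_low : ∃ K : NNReal, LipschitzOnWith K μ (Set.Iio (ζ ⟨0, hm⟩)))
    (hμ_high : ∃ K : NNReal, LipschitzOnWith K μ (Set.Ioi (ζ ⟨m - 1, Nat.sub_lt hm one_pos⟩)))
    (hμ_mid : ∀ (k : Fin m) (h : (k : ℕ) + 1 < m),
      ∃ K : NNReal, LipschitzOnWith K μ (Set.Ioo (ζ k) (ζ ⟨(k : ℕ) + 1, h⟩)))
    (hσ_lip : ∃ K : NNReal, LipschitzWith K σ)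
    (hσ_nz : ∀ k : Fin m, σ (ζ k) ≠ 0)
    (hρ_lip : ∃ K : NNReal, LipschitzWith K ρ)
    (ξ : ℝ) :
    ∃ C : ℝ, 0 < C ∧ ∃ δ0 : ℝ, δ0 ∈ Set.Ioo (0:ℝ) 1 ∧ ∀ n : ℕ, 0 < n → T / n < δ0 →
      ∀ (k : Fin m) (s t : ℝ), s ∈ Set.Icc (0:ℝ) T → t ∈ Set.Icc (0:ℝ) T →
      T / n ≤ lastGrid (T / n) t - s →
      P (crossEvent μ σ ρ W N (T / n) ξ (ζ k) s ∩ crossEvent μ σ ρ W N (T / n) ξ (ζ k) t)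
        ≤ ENNReal.ofReal (C * (T / n)) * P (crossEvent μ σ ρ W N (T / n) ξ (ζ k) s)
          + ENNReal.ofReal C *
            ∫⁻ z : ℝ, P (crossEvent μ σ ρ W N (T / n) ξ (ζ k) s ∩
                {ω | |emProc μ σ ρ W N (T / n) ξ
                    (lastGrid (T / n) t - (t - lastGrid (T / n) t)) ω - ζ k|
                  ≤ C * Real.sqrt (T / n) * (1 + |z|)})
              * ENNReal.ofReal (Real.exp (-z ^ 2 / 2)) := by
  obtain ⟨Kμ, hKμ, hμg⟩ := emx_mu_growth μ m hm ζ hμ_low hμ_high hμ_mid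
  obtain ⟨Kσ, hKσ, hσg⟩ := emx_lip_growth σ Set.univ
    (by obtain ⟨K, hK⟩ := hσ_lip; exact ⟨K, hK.lipschitzOnWith⟩)
  have hlam0 : 0 ≤ lamB := by
    have h0 : (0:ℝ) ∈ Set.Icc (0:ℝ) T := ⟨le_rfl, hT.le⟩
    exact (hlam_pos 0 h0).le.trans (hlamB 0 h0)
  set M : ℝ := ∑ k, |ζ k| with hM
  have hM0 : 0 ≤ M := Finset.sum_nonneg fun _ _ => abs_nonneg _
  have hMk : ∀ k, |ζ k| ≤ M := fun k =>
    Finset.single_le_sum (f := fun k => |ζ k|) (fun _ _ => abs_nonneg _) (Finset.mem_univ k)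
  set K : ℝ := (Kμ + Kσ) * (1 + M) + 1 with hKdef
  have hK1 : 1 ≤ K := by
    have : 0 ≤ (Kμ + Kσ) * (1 + M) := by positivity
    linarith
  have hK0 : 0 < K := by linarith
  have hμK : ∀ k y, |μ y| ≤ K * (1 + |y - ζ k|) := by
    intro k y
    refine (emx_center μ Kμ M (ζ k) hKμ (hMk k) hμg y).trans ?_
    gcongr
    have : 0 ≤ Kσ * (1 + M) := by positivity
    rw [hKdef]; linarith
  have hσK : ∀ k y, |σ y| ≤ K * (1 + |y - ζ k|) := by
    intro k y
    refine (emx_center σ Kσ M (ζ k) hKσ (hMk k) (fun x => hσg x (Set.mem_univ x)) y).trans ?_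
    gcongr
    have : 0 ≤ Kμ * (1 + M) := by positivity
    rw [hKdef]; linarith
  set c : ℝ := 1 / (8 * K) with hc
  have hc0 : 0 < c := by positivity
  have hc1 : c < 1 := by
    rw [hc, div_lt_one (by positivity)]; linarith
  set L : ℝ := lamB + 1 / c ^ 2 with hL
  have hL0 : 0 ≤ L := by positivity
  set C : ℝ := 16 * K + 3 * L + 2 with hC
  have hC0 : 0 < C := by positivity
  refine ⟨C, hC0, c, ⟨hc0, hc1⟩, ?_⟩
  intro n hn hδc k s t hs ht hst
  have hn' : (0:ℝ) < n := by exact_mod_cast hn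
  set δ : ℝ := T / n with hδdef
  have hδ : 0 < δ := by positivity
  obtain ⟨hbt, htb⟩ := emx_lastGrid_spec δ t hδ ht.1
  set b : ℝ := lastGrid δ t with hb
  obtain ⟨j, hj⟩ : ∃ j : ℕ, ⌊t / δ⌋.toNat = j + 1 := by
    apply Nat.exists_eq_succ_of_ne_zero
    intro h0
    have : b = 0 := by rw [hb]; unfold lastGrid; rw [h0]; simp
    linarith [hs.1]
  have hbj : b = ((j:ℝ) + 1) * δ := by
    rw [hb]; unfold lastGrid; rw [hj]; push_cast; ring
  set a : ℝ := j * δ with ha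
  set u : ℝ := b - (t - b) with hu
  have ha0 : 0 ≤ a := by positivity
  have hba : b = a + δ := by rw [hbj, ha]; ring
  have hsa : s ≤ a := by linarith
  have hau : a ≤ u := by linarith
  have hub : u ≤ b := by linarith
  have hbT : b ≤ T := hbt.trans ht.2
  have huT : u ∈ Set.Icc (0:ℝ) T := ⟨by linarith, by linarith⟩
  set A := crossEvent μ σ ρ W N δ ξ (ζ k) s with hA
  have hAs : MeasurableSet[F s] A :=
    emx_cross_meas F T W N hW_adapted hN_adapted μ σ ρ hμ_meas hσ_meas hρ_meas δ ξ (ζ k) hδ s hs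
  have hAF : ∀ h, s ≤ h → MeasurableSet[F h] A := fun h hh => F.mono hh A hAs
  have hXu : Measurable[F u] (emProc μ σ ρ W N δ ξ u) :=
    emx_proc_meas F T W N hW_adapted hN_adapted μ σ ρ hμ_meas hσ_meas hρ_meas δ ξ hδ u huT
  set X := emProc μ σ ρ W N δ ξ u with hX
  have hbad : ∀ h h', a ≤ h → h ≤ h' → h' ≤ T → h' - h ≤ δ →
      P (A ∩ {ω | N h' ω ≠ N h ω ∨ c < |W h' ω - W h ω|}) ≤ ENNReal.ofReal (L * δ) * P A := by
    intro h h' h1 h2 h3 h4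
    exact emx_bad F P T lam hlam_pos lamB hlamB W N hW_adapted hN_adapted hW_gauss hN_poisson
      h_indep hlam0 c δ h h' hc0 (ha0.trans h1) h2 h3 h4 A (hAF h (hsa.trans h1))
  set I := ∫⁻ z : ℝ, P (A ∩ {ω | |X ω - ζ k| ≤ C * Real.sqrt δ * (1 + |z|)})
              * ENNReal.ofReal (Real.exp (-z ^ 2 / 2)) with hI
  have htb0 : 0 ≤ t - b := sub_nonneg.2 hbt
  have hgood : ∀ h h', u ≤ h → h ≤ h' → h' ≤ T → h' - h = t - b →
      P (A ∩ {ω | |X ω - ζ k| ≤ 16 * K * ((t - b) + |W h' ω - W h ω|)}) ≤ I := by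
    intro h h' h1 h2 h3 h4
    have hh0 : 0 ≤ h := by linarith
    have hWm : Measurable (fun ω => W h' ω - W h ω) :=
      ((hW_adapted h' ⟨hh0.trans h2, h3⟩).mono (F.le _) le_rfl).sub
        ((hW_adapted h ⟨hh0, h2.trans h3⟩).mono (F.le _) le_rfl)
    have hle : MeasurableSpace.comap (fun ω => W h' ω - W h ω) inferInstance ≤
        MeasurableSpace.comap (fun ω => (W h' ω - W h ω, N h' ω - N h ω)) inferInstance := by
      rintro S ⟨S', hS', rfl⟩
      exact ⟨Prod.fst ⁻¹' S', measurable_fst hS', rfl⟩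
    have hind := indep_of_indep_of_le_left (h_indep h h' hh0 h2 h3) hle
    have hr : Measurable (fun d : ℝ => 16 * K * ((t - b) + |d|)) := by fun_prop
    have key := emx_indep_int (F h) P (F.le h) _ hWm hind _ (hW_gauss h h' hh0 h2 h3) A
      (hAF h (by linarith)) X (hXu.mono (F.mono h1) le_rfl) (ζ k)
      (fun d => 16 * K * ((t - b) + |d|)) hr
    rw [key]
    refine (emx_gauss_le _).trans (lintegral_mono fun z => ?_)
    dsimp only
    refine mul_le_mul_left (measure_mono ?_) _
    intro ω hω
    have hω2 : |X ω - ζ k| ≤ 16 * K * (t - b + |Real.sqrt ((h' - h).toNNReal : ℝ) * z|) := hω.2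
    refine ⟨hω.1, ?_⟩
    change |X ω - ζ k| ≤ C * Real.sqrt δ * (1 + |z|)
    refine hω2.trans ?_
    rw [h4, Real.coe_toNNReal _ htb0, abs_mul, abs_of_nonneg (Real.sqrt_nonneg _)]
    have q1 : t - b ≤ Real.sqrt δ := by
      apply Real.le_sqrt_of_sq_le
      have : t - b ≤ δ := by linarith
      nlinarith
    have q2 : Real.sqrt (t - b) ≤ Real.sqrt δ := Real.sqrt_le_sqrt (by linarith)
    calc 16 * K * ((t - b) + Real.sqrt (t - b) * |z|)
        ≤ 16 * K * (Real.sqrt δ + Real.sqrt δ * |z|) := by gcongr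
      _ = 16 * K * Real.sqrt δ * (1 + |z|) := by ring
      _ ≤ C * Real.sqrt δ * (1 + |z|) := by
        gcongr; rw [hC]; linarith
  have hcover : A ∩ crossEvent μ σ ρ W N δ ξ (ζ k) t ⊆
      (((A ∩ {ω | N u ω ≠ N a ω ∨ c < |W u ω - W a ω|})
        ∪ (A ∩ {ω | N b ω ≠ N u ω ∨ c < |W b ω - W u ω|}))
        ∪ (A ∩ {ω | N t ω ≠ N b ω ∨ c < |W t ω - W b ω|}))
      ∪ ((A ∩ {ω | |X ω - ζ k| ≤ 16 * K * ((t - b) + |W b ω - W u ω|)})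
        ∪ (A ∩ {ω | |X ω - ζ k| ≤ 16 * K * ((t - b) + |W t ω - W b ω|)})) := by
    rintro ω ⟨hωA, hωt⟩
    by_cases b0 : N u ω ≠ N a ω ∨ c < |W u ω - W a ω|
    · exact Or.inl (Or.inl (Or.inl ⟨hωA, b0⟩))
    by_cases b1 : N b ω ≠ N u ω ∨ c < |W b ω - W u ω|
    · exact Or.inl (Or.inl (Or.inr ⟨hωA, b1⟩))
    by_cases b2 : N t ω ≠ N b ω ∨ c < |W t ω - W b ω|
    · exact Or.inl (Or.inr ⟨hωA, b2⟩)
    right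
    simp only [not_or, not_not, not_lt] at b0 b1 b2
    have := emx_path μ σ ρ W N δ ξ (ζ k) K hδ hK1 (hμK k) (hσK k) hδc.le t a b u j ha hbj hu hbt htb
      ω b0.1 b1.1 b2.1 b0.2 b1.2 b2.2 hωt
    have p0 : 0 ≤ K * (t - b) := by positivity
    rcases le_total (|W b ω - W u ω|) (|W t ω - W b ω|) with hle | hle
    · right
      refine ⟨hωA, this.trans ?_⟩
      have := mul_le_mul_of_nonneg_left hle hK0.le
      linarith
    · left
      refine ⟨hωA, this.trans ?_⟩
      have := mul_le_mul_of_nonneg_left hle hK0.le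
      linarith
  refine (measure_mono hcover).trans ?_
  have hB0 := hbad a u le_rfl hau huT.2 (by linarith)
  have hB1 := hbad u b hau hub hbT (by linarith)
  have hB2 := hbad b t (by linarith) hbt ht.2 (by linarith)
  have hG1 := hgood u b le_rfl hub hbT (by rw [hu]; ring)
  have hG2 := hgood b t hub hbt ht.2 rfl
  have hsum := (measure_union_le _ _).trans (add_le_add
    ((measure_union_le _ _).trans (add_le_add ((measure_union_le _ _).trans (add_le_add hB0 hB1)) hB2))
    ((measure_union_le _ _).trans (add_le_add hG1 hG2)))
  refine hsum.trans ?_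
  have hLC : ENNReal.ofReal (L * δ) + ENNReal.ofReal (L * δ) + ENNReal.ofReal (L * δ)
      ≤ ENNReal.ofReal (C * δ) := by
    rw [← ENNReal.ofReal_add (by positivity) (by positivity),
      ← ENNReal.ofReal_add (by positivity) (by positivity)]
    apply ENNReal.ofReal_le_ofReal
    have : 0 ≤ (16 * K + 2) * δ := by positivity
    rw [hC]; linarith
  have h2C : (2:ENNReal) ≤ ENNReal.ofReal C := by
    have : (2:ENNReal) = ENNReal.ofReal 2 := by simp
    rw [this]
    apply ENNReal.ofReal_le_ofReal
    rw [hC]; linarith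
  apply add_le_add
  · rw [← add_mul, ← add_mul]
    gcongr
  · rw [← two_mul]
    gcongr
end
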